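/- arXiv:2310.06612 — 2 statements merged into one kernel-verified Lean document; each statement's English description precedes it below -/
import Mathlib

section
/- Let n be an odd integer and let k be an integer with 4 ≤ k ≤ ⌊n/2⌋ and gcd(n,k) = 1; write n = a·k + r with 2 ≤ r ≤ k − 2. Let t be defined from the remainder algorithm as follows: with k_0 = k, r_0 = r, k_{i+1} = k_i − r_i and r_{i+1} = (k_i mod k_{i+1}), let m be the least nonnegative integer with r_{m+1} = 0 (so k_{m+1} = 1); if there exists a minimal positive integer s < m with k_s ≥ 3 and r_s = 1, set t = k_s + 1, otherwise set t = k_m. If t is odd and t ≥ 3, then mbt(C(n,k)) = Δ(C(n,k)) + 1 = 5. -/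
open SimpleGraph

/-- The circulant graph `C(ℤ_n, S)`: vertices are `ZMod n`, and distinct `i, j` are
adjacent iff `i - j ≡ s` or `i - j ≡ -s (mod n)` for some `s ∈ S`. -/
def circulant (n : ℕ) (S : Set ℤ) : SimpleGraph (ZMod n) :=
  SimpleGraph.fromRel fun i j => ∃ s ∈ S, i - j = (s : ZMod n)

/-- `C(n,k) = C(ℤ_n, {1, k})`. -/
def circ (n k : ℕ) : SimpleGraph (ZMod n) := circulant n {1, (k : ℤ)}

/-- The maximum degree `Δ(G)` of a graph. -/
noncomputable def maxDeg {V : Type*} (G : SimpleGraph V) : ℕ :=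
  sSup (Set.range fun v => (G.neighborSet v).ncard)

/-- `x` lies strictly between positions `a` and `b` on the circular layout
(cut open along the linear order of `Fin N`). -/
def ChordBetween {N : ℕ} (x a b : Fin N) : Prop := min a b < x ∧ x < max a b

/-- The chords joining the positions `a,b` and `c,d` on a circle cross iff exactly one of
`c, d` lies strictly between `a` and `b`. -/
def ChordCross {N : ℕ} (a b c d : Fin N) : Prop :=
  Xor' (ChordBetween c a b) (ChordBetween d a b)

/-- `G` admits a matching book embedding in `m` pages: there is a circular layout
(a bijection of the vertices with `Fin (Nat.card V)`) and a proper edge coloring with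
`m` colors such that crossing edges get distinct colors. -/
def HasMBE {V : Type*} (G : SimpleGraph V) (m : ℕ) : Prop :=
  ∃ (σ : V ≃ Fin (Nat.card V)) (col : V → V → Fin m),
    (∀ u v, G.Adj u v → col u v = col v u) ∧
    (∀ u v w, G.Adj u v → G.Adj u w → v ≠ w → col u v ≠ col u w) ∧
    (∀ a b c d, G.Adj a b → G.Adj c d →
      ChordCross (σ a) (σ b) (σ c) (σ d) → col a b ≠ col c d)

/-- The matching book thickness `mbt(G)`. -/
noncomputable def mbt {V : Type*} (G : SimpleGraph V) : ℕ :=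
  sInf {m | HasMBE G m}

/-- The remainder algorithm from the paper: `k₀ = k`, `r₀ = r`,
`k_{i+1} = k_i - r_i`, `r_{i+1} = k_i mod k_{i+1}`. -/
def euclidSeq (k r : ℕ) : ℕ → ℕ × ℕ
  | 0 => (k, r)
  | i + 1 =>
      ((euclidSeq k r i).1 - (euclidSeq k r i).2,
       (euclidSeq k r i).1 % ((euclidSeq k r i).1 - (euclidSeq k r i).2))

namespace MBT

def ChA (b k r i j li lp hi hp : ℕ) : Prop :=
  i % 2 = 0 ∧ i + 2 ≤ b ∧ 1 ≤ j ∧ j ≤ k ∧ li = i ∧ lp = 2 * j ∧ hi = i + 1 ∧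
    ((i + 2 = b ∧ j < r ∧ hp + 2 * j = 2 * k + j % 2) ∨
      (¬ (i + 2 = b ∧ j < r) ∧ hp + 2 * j = 2 * k))

def ChB (b k r i j li lp hi hp : ℕ) : Prop :=
  (i % 2 = 1 ∧ i + 3 ≤ b ∧ 1 ≤ j ∧ j ≤ k ∧ li = i ∧ lp + 2 * j = 2 * k ∧ hi = i + 1 ∧ hp = 2 * j) ∨
  (li = 0 ∧ lp = 2 ∧ hi = 0 ∧ hp = 4) ∨
  (li + 1 = b ∧ lp + 2 * r = 2 * k ∧ hi = li ∧ hp = lp + 2) ∨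
  (li + 1 = b ∧ lp = 1 ∧ hi = li ∧ hp = 2) ∨
  (li = 0 ∧ lp = 2 * k ∧ hi + 1 = b ∧ hp + 2 * r = 2 * k + 3) ∨
  (1 ≤ j ∧ j + 2 ≤ r ∧ li = 0 ∧ lp + 2 * r = 2 * k + 2 * j ∧ hi + 1 = b ∧
    hp + 2 * j + j % 2 = 2 * k + 1)

def ChC (b k r i j li lp hi hp : ℕ) : Prop :=
  (i % 2 = 0 ∧ i + 2 ≤ b ∧ li = i ∧ lp = 2 ∧ hi = i ∧ hp = 2 * k) ∨
  (i % 2 = 1 ∧ i + 2 ≤ b ∧ li = i ∧ lp = 0 ∧ hi = i ∧ hp + 2 = 2 * k) ∨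
  (i % 2 = 0 ∧ i + 2 ≤ b ∧ 2 ≤ j ∧ j + 2 ≤ k ∧ (j + k) % 2 = 0 ∧ li = i ∧ lp = 2 * j ∧ hi = i ∧
    hp = 2 * j + 2) ∨
  (i % 2 = 1 ∧ i + 2 ≤ b ∧ 2 ≤ j ∧ j + 2 ≤ k ∧ (j + k) % 2 = 0 ∧ li = i ∧ lp + 2 * j + 2 = 2 * k ∧
    hi = i ∧ hp + 2 * j = 2 * k) ∨
  (r ≤ j ∧ j + 2 ≤ k ∧ j % 2 = 1 ∧ li + 1 = b ∧ lp + 2 * j + 2 = 2 * k ∧ hi = li ∧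
    hp + 2 * j = 2 * k) ∨
  (li + 1 = b ∧ lp = 0 ∧ hi = li ∧ hp + 1 = 2 * k) ∨
  (2 ≤ j ∧ j + 3 ≤ r ∧ j % 2 = 0 ∧ li + 1 = b ∧ lp + 2 * j + 1 = 2 * k ∧ hi = li ∧
    hp + 2 * j = 2 * k) ∨
  (li + 1 = b ∧ lp = 1 ∧ hi = li ∧ hp + 2 = 2 * k) ∨
  (2 ≤ j ∧ j + 3 ≤ r ∧ j % 2 = 0 ∧ li + 1 = b ∧ lp + 2 * j + 2 = 2 * k ∧ hi = li ∧
    hp + 2 * j = 2 * k + 1) ∨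
  (li + 1 = b ∧ lp + 2 * r = 2 * k + 2 ∧ hi = li ∧ hp = lp + 1)

def ChD (b k r i j li lp hi hp : ℕ) : Prop :=
  (i % 2 = 0 ∧ i + 2 ≤ b ∧ 2 ≤ j ∧ j + 2 ≤ k ∧ (j + k) % 2 = 1 ∧ li = i ∧ lp = 2 * j ∧ hi = i ∧
    hp = 2 * j + 2) ∨
  (i % 2 = 1 ∧ i + 2 ≤ b ∧ 2 ≤ j ∧ j + 2 ≤ k ∧ (j + k) % 2 = 1 ∧ li = i ∧ lp + 2 * j + 2 = 2 * k ∧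
    hi = i ∧ hp + 2 * j = 2 * k) ∨
  (i % 2 = 1 ∧ i + 3 ≤ b ∧ li = i ∧ lp = 2 ∧ hi = i + 1 ∧ hp = 2 * k) ∨
  (r ≤ j ∧ j + 2 ≤ k ∧ j % 2 = 0 ∧ li + 1 = b ∧ lp + 2 * j + 2 = 2 * k ∧ hi = li ∧
    hp + 2 * j = 2 * k) ∨
  (j + 3 ≤ r ∧ j % 2 = 1 ∧ li + 1 = b ∧ lp + 2 * j + 2 = 2 * k ∧ hi = li ∧
    hp + 2 * j = 2 * k + 1) ∨
  (j + 3 ≤ r ∧ j % 2 = 1 ∧ li + 1 = b ∧ lp + 2 * j + 1 = 2 * k ∧ hi = li ∧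
    hp + 2 * j = 2 * k) ∨
  (li + 1 = b ∧ lp = 0 ∧ hi = li ∧ hp = 1) ∨
  (li + 1 = b ∧ lp + 2 * r = 2 * k + 4 ∧ hi = li ∧ hp = lp + 1) ∨
  (li = 0 ∧ lp = 2 * k ∧ hi + 1 = b ∧ hp + 2 * r = 2 * k) ∨
  (li = 0 ∧ lp + 2 = 2 * k ∧ hi + 1 = b ∧ hp + 2 * r = 2 * k + 3)

def ChE (b k r i j li lp hi hp : ℕ) : Prop :=
  (i % 2 = 0 ∧ 1 ≤ i ∧ i + 2 ≤ b ∧ li = i ∧ lp = 2 ∧ hi = i ∧ hp = 4) ∨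
  (i % 2 = 1 ∧ i + 2 ≤ b ∧ li = i ∧ lp + 4 = 2 * k ∧ hi = i ∧ hp + 2 = 2 * k) ∨
  (i % 2 = 0 ∧ i + 2 ≤ b ∧ li = i ∧ lp + 2 = 2 * k ∧ hi = i + 1 ∧ hp = 0) ∨
  (li + 1 = b ∧ lp + 2 * r = 2 * k + 2 ∧ hi = li ∧ hp + 2 * r = 2 * k + 5) ∨
  (li + 1 = b ∧ lp + 2 * r = 2 * k + 3 ∧ hi = li ∧ hp + 2 * r = 2 * k + 4) ∨
  (1 ≤ j ∧ j + 3 ≤ r ∧ li + 1 = b ∧ lp + 2 * j = 2 * k ∧ hi = li ∧ hp = lp + 1) ∨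
  (r < j ∧ j < k ∧ li = 0 ∧ lp + 2 * r = 2 * j ∧ hi + 1 = b ∧ hp + 2 * j = 2 * k) ∨
  (li = 0 ∧ lp + 2 * r = 2 * k ∧ hi + 1 = b ∧ hp = 1)

/-- lexicographic `≤` -/
def LE2 (a p c q : ℕ) : Prop := a < c ∨ (a = c ∧ p ≤ q)

def Good (li lp hi hp li' lp' hi' hp' : ℕ) : Prop :=
  LE2 li lp li' lp' → LE2 li' lp' hi hp → LE2 hi hp hi' hp' →
    (li = li' ∧ lp = lp' ∧ hi = hi' ∧ hp = hp')

theorem goodA {b k r : ℕ} (hb : b % 2 = 0) (hb2 : 2 ≤ b) (hr : r % 2 = 1) (hr3 : 3 ≤ r)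
    (hrk : r + 2 ≤ k) {i j li lp hi hp i' j' li' lp' hi' hp' : ℕ}
    (h : ChA b k r i j li lp hi hp) (h' : ChA b k r i' j' li' lp' hi' hp') :
    Good li lp hi hp li' lp' hi' hp' := by
  unfold ChA at h h'
  unfold Good LE2
  omega

theorem goodB {b k r : ℕ} (hb : b % 2 = 0) (hb2 : 2 ≤ b) (hr : r % 2 = 1) (hr3 : 3 ≤ r)
    (hrk : r + 2 ≤ k) {i j li lp hi hp i' j' li' lp' hi' hp' : ℕ}
    (h : ChB b k r i j li lp hi hp) (h' : ChB b k r i' j' li' lp' hi' hp') :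
    Good li lp hi hp li' lp' hi' hp' := by
  unfold ChB at h h'
  unfold Good LE2
  rcases h with h | h | h | h | h | h <;> rcases h' with h' | h' | h' | h' | h' | h' <;> omega

theorem goodC {b k r : ℕ} (hb : b % 2 = 0) (hb2 : 2 ≤ b) (hr : r % 2 = 1) (hr3 : 3 ≤ r)
    (hrk : r + 2 ≤ k) {i j li lp hi hp i' j' li' lp' hi' hp' : ℕ}
    (h : ChC b k r i j li lp hi hp) (h' : ChC b k r i' j' li' lp' hi' hp') :
    Good li lp hi hp li' lp' hi' hp' := by
  unfold ChC at h h'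
  unfold Good LE2
  rcases h with h | h | h | h | h | h | h | h | h | h <;>
  rcases h' with h' | h' | h' | h' | h' | h' | h' | h' | h' | h' <;> omega

theorem goodD {b k r : ℕ} (hb : b % 2 = 0) (hb2 : 2 ≤ b) (hr : r % 2 = 1) (hr3 : 3 ≤ r)
    (hrk : r + 2 ≤ k) {i j li lp hi hp i' j' li' lp' hi' hp' : ℕ}
    (h : ChD b k r i j li lp hi hp) (h' : ChD b k r i' j' li' lp' hi' hp') :
    Good li lp hi hp li' lp' hi' hp' := by
  unfold ChD at h h'
  unfold Good LE2
  rcases h with h | h | h | h | h | h | h | h | h | h <;>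
  rcases h' with h' | h' | h' | h' | h' | h' | h' | h' | h' | h' <;> omega

theorem goodE {b k r : ℕ} (hb : b % 2 = 0) (hb2 : 2 ≤ b) (hr : r % 2 = 1) (hr3 : 3 ≤ r)
    (hrk : r + 2 ≤ k) {i j li lp hi hp i' j' li' lp' hi' hp' : ℕ}
    (h : ChE b k r i j li lp hi hp) (h' : ChE b k r i' j' li' lp' hi' hp') :
    Good li lp hi hp li' lp' hi' hp' := by
  unfold ChE at h h'
  unfold Good LE2
  rcases h with h | h | h | h | h | h | h | h <;>
  rcases h' with h' | h' | h' | h' | h' | h' | h' | h' <;> omega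

end MBT

namespace MBT

/-- position of the vertex `i * k + j` as a relation -/
def IsPos (b k r i j a p : ℕ) : Prop :=
  (i + 1 < b ∧ a = i ∧ i % 2 = 0 ∧ 1 ≤ j ∧ p = 2 * j) ∨
  (i + 1 < b ∧ a = i ∧ i % 2 = 0 ∧ j = 0 ∧ p = 2 * k) ∨
  (i + 1 < b ∧ a = i ∧ i % 2 = 1 ∧ 1 ≤ j ∧ p + 2 * j = 2 * k) ∨
  (i + 1 < b ∧ a = i ∧ i % 2 = 1 ∧ j = 0 ∧ p = 0) ∨
  (i + 1 = b ∧ a = i ∧ j = 0 ∧ p = 0) ∨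
  (i + 1 = b ∧ a = i ∧ 1 ≤ j ∧ j < r ∧ p + 2 * j = 2 * k + j % 2) ∨
  (i + 1 = b ∧ a = i ∧ r ≤ j ∧ 1 ≤ j ∧ p + 2 * j = 2 * k) ∨
  (i = b ∧ a + 1 = b ∧ j = 0 ∧ p = 1) ∨
  (i = b ∧ a + 1 = b ∧ 1 ≤ j ∧ p + 2 * j + j % 2 = 2 * k + 1)

def Valid (b k r i j : ℕ) : Prop := (i < b ∧ j < k) ∨ (i = b ∧ j < r)

theorem isPos_exists {b k r i j : ℕ} (hb2 : 2 ≤ b) (hrk : r + 2 ≤ k)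
    (h : Valid b k r i j) : ∃ a p, IsPos b k r i j a p := by
  unfold Valid at h
  unfold IsPos
  rcases h with ⟨h1, h2⟩ | ⟨h1, h2⟩
  · rcases Nat.lt_or_ge (i + 1) b with hi | hi
    · rcases Nat.mod_two_eq_zero_or_one i with he | he
      · rcases Nat.eq_zero_or_pos j with hj | hj
        · exact ⟨i, 2 * k, Or.inr (Or.inl (by omega))⟩
        · exact ⟨i, 2 * j, Or.inl (by omega)⟩
      · rcases Nat.eq_zero_or_pos j with hj | hj
        · exact ⟨i, 0, Or.inr (Or.inr (Or.inr (Or.inl (by omega))))⟩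
        · exact ⟨i, 2 * k - 2 * j, Or.inr (Or.inr (Or.inl (by omega)))⟩
    · rcases Nat.eq_zero_or_pos j with hj | hj
      · exact ⟨i, 0, Or.inr (Or.inr (Or.inr (Or.inr (Or.inl (by omega)))))⟩
      · rcases Nat.lt_or_ge j r with hjr | hjr
        · exact ⟨i, 2 * k + j % 2 - 2 * j, Or.inr (Or.inr (Or.inr (Or.inr (Or.inr (Or.inl (by omega))))))⟩
        · exact ⟨i, 2 * k - 2 * j, Or.inr (Or.inr (Or.inr (Or.inr (Or.inr (Or.inr (Or.inl (by omega)))))))⟩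
  · rcases Nat.eq_zero_or_pos j with hj | hj
    · exact ⟨b - 1, 1, Or.inr (Or.inr (Or.inr (Or.inr (Or.inr (Or.inr (Or.inr (Or.inl (by omega))))))))⟩
    · exact ⟨b - 1, 2 * k + 1 - j % 2 - 2 * j, Or.inr (Or.inr (Or.inr (Or.inr (Or.inr (Or.inr (Or.inr (Or.inr (by omega))))))))⟩

theorem isPos_inj {b k r i j i' j' a p : ℕ} (hb2 : 2 ≤ b) (hrk : r + 2 ≤ k)
    (v : Valid b k r i j) (v' : Valid b k r i' j')
    (h : IsPos b k r i j a p) (h' : IsPos b k r i' j' a p) : i = i' ∧ j = j' := by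
  unfold Valid at v v'
  unfold IsPos at h h'
  rcases h with h | h | h | h | h | h | h | h | h <;>
  rcases h' with h' | h' | h' | h' | h' | h' | h' | h' | h' <;>
  first
  | omega
  | (rcases Nat.mod_two_eq_zero_or_one j with hj | hj <;>
      rcases Nat.mod_two_eq_zero_or_one j' with hj' | hj' <;> omega)

theorem q0 {b k r i j a p : ℕ} (h : IsPos b k r i j a p)
    (hc : i + 1 < b ∧ i % 2 = 0 ∧ 1 ≤ j) : a = i ∧ p = 2 * j := by
  unfold IsPos at h
  omega

theorem q1 {b k r i j a p : ℕ} (h : IsPos b k r i j a p)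
    (hc : i + 1 < b ∧ i % 2 = 0 ∧ j = 0) : a = i ∧ p = 2 * k := by
  unfold IsPos at h
  omega

theorem q2 {b k r i j a p : ℕ} (h : IsPos b k r i j a p)
    (hc : i + 1 < b ∧ i % 2 = 1 ∧ 1 ≤ j) : a = i ∧ p + 2 * j = 2 * k := by
  unfold IsPos at h
  omega

theorem q3 {b k r i j a p : ℕ} (h : IsPos b k r i j a p)
    (hc : i + 1 < b ∧ i % 2 = 1 ∧ j = 0) : a = i ∧ p = 0 := by
  unfold IsPos at h
  omega

theorem q4 {b k r i j a p : ℕ} (h : IsPos b k r i j a p)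
    (hc : i + 1 = b ∧ j = 0) : a = i ∧ p = 0 := by
  unfold IsPos at h
  omega

theorem q5 {b k r i j a p : ℕ} (h : IsPos b k r i j a p)
    (hc : i + 1 = b ∧ 1 ≤ j ∧ j < r) : a = i ∧ p + 2 * j = 2 * k + j % 2 := by
  unfold IsPos at h
  omega

theorem q6 {b k r i j a p : ℕ} (h : IsPos b k r i j a p)
    (hc : i + 1 = b ∧ r ≤ j ∧ 1 ≤ j) : a = i ∧ p + 2 * j = 2 * k := by
  unfold IsPos at h
  omega

theorem q7 {b k r i j a p : ℕ} (h : IsPos b k r i j a p)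
    (hc : i = b ∧ j = 0) : a + 1 = b ∧ p = 1 := by
  unfold IsPos at h
  omega

theorem q8 {b k r i j a p : ℕ} (h : IsPos b k r i j a p)
    (hc : i = b ∧ 1 ≤ j) : a + 1 = b ∧ p + 2 * j + j % 2 = 2 * k + 1 := by
  unfold IsPos at h
  omega

/-- chord of colour `c` -/
def Chord (b k r : ℕ) (c : Fin 5) (li lp hi hp : ℕ) : Prop :=
  ∃ i j, (c = 0 ∧ ChA b k r i j li lp hi hp) ∨ (c = 1 ∧ ChB b k r i j li lp hi hp) ∨
    (c = 2 ∧ ChC b k r i j li lp hi hp) ∨ (c = 3 ∧ ChD b k r i j li lp hi hp) ∨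
    (c = 4 ∧ ChE b k r i j li lp hi hp)

theorem Chord.mkA {b k r i j li lp hi hp : ℕ} (h : ChA b k r i j li lp hi hp) :
    Chord b k r 0 li lp hi hp := ⟨i, j, by simp [h]⟩
theorem Chord.mkB {b k r i j li lp hi hp : ℕ} (h : ChB b k r i j li lp hi hp) :
    Chord b k r 1 li lp hi hp := ⟨i, j, by simp [h]⟩
theorem Chord.mkC {b k r i j li lp hi hp : ℕ} (h : ChC b k r i j li lp hi hp) :
    Chord b k r 2 li lp hi hp := ⟨i, j, by simp [h]⟩
theorem Chord.mkD {b k r i j li lp hi hp : ℕ} (h : ChD b k r i j li lp hi hp) :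
    Chord b k r 3 li lp hi hp := ⟨i, j, by simp [h]⟩
theorem Chord.mkE {b k r i j li lp hi hp : ℕ} (h : ChE b k r i j li lp hi hp) :
    Chord b k r 4 li lp hi hp := ⟨i, j, by simp [h]⟩

theorem chord_good {b k r : ℕ} (hb : b % 2 = 0) (hb2 : 2 ≤ b) (hr : r % 2 = 1) (hr3 : 3 ≤ r)
    (hrk : r + 2 ≤ k) {c : Fin 5} {li lp hi hp li' lp' hi' hp' : ℕ}
    (h : Chord b k r c li lp hi hp) (h' : Chord b k r c li' lp' hi' hp') :
    Good li lp hi hp li' lp' hi' hp' := by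
  obtain ⟨i, j, h⟩ := h
  obtain ⟨i', j', h'⟩ := h'
  rcases h with ⟨rfl, h⟩ | ⟨rfl, h⟩ | ⟨rfl, h⟩ | ⟨rfl, h⟩ | ⟨rfl, h⟩
  · simp at h'
    exact goodA hb hb2 hr hr3 hrk h h'
  · simp at h'
    exact goodB hb hb2 hr hr3 hrk h h'
  · simp at h'
    exact goodC hb hb2 hr hr3 hrk h h'
  · simp at h'
    exact goodD hb hb2 hr hr3 hrk h h'
  · simp at h'
    exact goodE hb hb2 hr hr3 hrk h h'

/-- an edge whose end positions are `(a,p)` and `(a',p')` -/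
def Edge (b k r a p a' p' : ℕ) : Prop :=
  ∃ c, (Chord b k r c a p a' p' ∨ Chord b k r c a' p' a p)

set_option maxHeartbeats 2000000 in
/-- edges `x → x + 1` -/
theorem edge_one {b k r i j i' j' a p a' p' : ℕ} (hb : b % 2 = 0) (hb2 : 2 ≤ b)
    (hr : r % 2 = 1) (hr3 : 3 ≤ r) (hrk : r + 2 ≤ k) (v : Valid b k r i j)
    (v' : Valid b k r i' j')
    (hnext : (i' = i ∧ j' = j + 1) ∨ (j + 1 = k ∧ i < b ∧ i' = i + 1 ∧ j' = 0) ∨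
      (i = b ∧ j + 1 = r ∧ i' = 0 ∧ j' = 0))
    (h : IsPos b k r i j a p) (h' : IsPos b k r i' j' a' p') : Edge b k r a p a' p' := by
  unfold Valid at v v'
  unfold Edge
  rcases Nat.lt_or_ge (i + 1) b with hi | hi
  · rcases Nat.mod_two_eq_zero_or_one i with he | he
    · -- even row
      by_cases j0 : j = 0
      · refine ⟨2, Or.inr (Chord.mkC (i := i) (j := 0) ?_)⟩
        have hx : i' = i ∧ j' = j + 1 := by omega
        clear hnext v'
        replace h := q1 h (by omega)
        replace h' := q0 h' (by omega)
        left; omega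
      by_cases j1 : j = 1
      · by_cases i0 : i = 0
        · refine ⟨1, Or.inl (Chord.mkB (i := i) (j := 0) ?_)⟩
          have hx : i' = i ∧ j' = j + 1 := by omega
          clear hnext v'
          replace h := q0 h (by omega)
          replace h' := q0 h' (by omega)
          right; left; omega
        · refine ⟨4, Or.inl (Chord.mkE (i := i) (j := 0) ?_)⟩
          have hx : i' = i ∧ j' = j + 1 := by omega
          clear hnext v'
          replace h := q0 h (by omega)
          replace h' := q0 h' (by omega)
          left; omega
      by_cases jk : j + 1 = k
      · refine ⟨4, Or.inl (Chord.mkE (i := i) (j := 0) ?_)⟩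
        have hx : i' = i + 1 ∧ j' = 0 := by omega
        clear hnext v'
        replace h := q0 h (by omega)
        unfold IsPos at h'
        right; right; left; omega
      rcases Nat.mod_two_eq_zero_or_one (j + k) with hjk | hjk
      · refine ⟨2, Or.inl (Chord.mkC (i := i) (j := j) ?_)⟩
        have hx : i' = i ∧ j' = j + 1 := by omega
        clear hnext v'
        replace h := q0 h (by omega)
        replace h' := q0 h' (by omega)
        right; right; left; omega
      · refine ⟨3, Or.inl (Chord.mkD (i := i) (j := j) ?_)⟩
        have hx : i' = i ∧ j' = j + 1 := by omega
        clear hnext v'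
        replace h := q0 h (by omega)
        replace h' := q0 h' (by omega)
        left; omega
    · by_cases j0 : j = 0
      · refine ⟨2, Or.inl (Chord.mkC (i := i) (j := 0) ?_)⟩
        have hx : i' = i ∧ j' = j + 1 := by omega
        clear hnext v'
        replace h := q3 h (by omega)
        replace h' := q2 h' (by omega)
        right; left; omega
      by_cases j1 : j = 1
      · refine ⟨4, Or.inr (Chord.mkE (i := i) (j := 0) ?_)⟩
        have hx : i' = i ∧ j' = j + 1 := by omega
        clear hnext v'
        replace h := q2 h (by omega)
        replace h' := q2 h' (by omega)
        right; left; omega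
      by_cases jk : j + 1 = k
      · refine ⟨3, Or.inl (Chord.mkD (i := i) (j := 0) ?_)⟩
        have hx : i' = i + 1 ∧ j' = 0 := by omega
        clear hnext v'
        replace h := q2 h (by omega)
        replace h' := q1 h' (by omega)
        right; right; left; omega
      rcases Nat.mod_two_eq_zero_or_one (j + k) with hjk | hjk
      · refine ⟨2, Or.inr (Chord.mkC (i := i) (j := j) ?_)⟩
        have hx : i' = i ∧ j' = j + 1 := by omega
        clear hnext v'
        replace h := q2 h (by omega)
        replace h' := q2 h' (by omega)
        right; right; right; left; omega
      · refine ⟨3, Or.inr (Chord.mkD (i := i) (j := j) ?_)⟩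
        have hx : i' = i ∧ j' = j + 1 := by omega
        clear hnext v'
        replace h := q2 h (by omega)
        replace h' := q2 h' (by omega)
        right; left; omega
  by_cases h1 : i + 1 = b ∧ r ≤ j
  · by_cases jk : j + 1 = k
    · refine ⟨1, Or.inr (Chord.mkB (i := i) (j := j) ?_)⟩
      have hx : i' = i + 1 ∧ j' = 0 := by omega
      clear hnext v'
      replace h := q6 h (by omega)
      replace h' := q7 h' (by omega)
      right; right; right; left; omega
    rcases Nat.mod_two_eq_zero_or_one j with hj | hj
    · refine ⟨3, Or.inr (Chord.mkD (i := i) (j := j) ?_)⟩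
      have hx : i' = i ∧ j' = j + 1 := by omega
      clear hnext v'
      replace h := q6 h (by omega)
      replace h' := q6 h' (by omega)
      right; right; right; left; omega
    · refine ⟨2, Or.inr (Chord.mkC (i := i) (j := j) ?_)⟩
      have hx : i' = i ∧ j' = j + 1 := by omega
      clear hnext v'
      replace h := q6 h (by omega)
      replace h' := q6 h' (by omega)
      right; right; right; right; left; omega
  by_cases jr : j + 3 ≤ r
  · rcases Nat.mod_two_eq_zero_or_one j with hj | hj
    · by_cases hib : i = b
      · by_cases j0 : j = 0
        · refine ⟨2, Or.inl (Chord.mkC (i := i) (j := j) ?_)⟩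
          iterate 7 right
          have hx : i' = i ∧ j' = j + 1 := by omega
          clear hnext v'
          replace h := q7 h (by omega)
          replace h' := q8 h' (by omega)
          left; omega
        · refine ⟨2, Or.inr (Chord.mkC (i := i) (j := j) ?_)⟩
          iterate 8 right
          have hx : i' = i ∧ j' = j + 1 := by omega
          clear hnext v'
          replace h := q8 h (by omega)
          replace h' := q8 h' (by omega)
          left; omega
      · by_cases j0 : j = 0
        · refine ⟨2, Or.inl (Chord.mkC (i := i) (j := j) ?_)⟩
          iterate 5 right
          have hx : i' = i ∧ j' = j + 1 := by omega
          clear hnext v'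
          replace h := q4 h (by omega)
          replace h' := q5 h' (by omega)
          left; omega
        · refine ⟨2, Or.inr (Chord.mkC (i := i) (j := j) ?_)⟩
          iterate 6 right
          have hx : i' = i ∧ j' = j + 1 := by omega
          clear hnext v'
          replace h := q5 h (by omega)
          replace h' := q5 h' (by omega)
          left; omega
    · by_cases hib : i = b
      · refine ⟨3, Or.inr (Chord.mkD (i := i) (j := j) ?_)⟩
        iterate 5 right
        have hx : i' = i ∧ j' = j + 1 := by omega
        clear hnext v'
        replace h := q8 h (by omega)
        replace h' := q8 h' (by omega)
        left; omega
      · refine ⟨3, Or.inr (Chord.mkD (i := i) (j := j) ?_)⟩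
        iterate 4 right
        have hx : i' = i ∧ j' = j + 1 := by omega
        clear hnext v'
        replace h := q5 h (by omega)
        replace h' := q5 h' (by omega)
        left; omega
  by_cases jr2 : j + 2 = r
  · by_cases hib : i = b
    · refine ⟨4, Or.inr (Chord.mkE (i := i) (j := j) ?_)⟩
      iterate 4 right
      have hx : i' = i ∧ j' = j + 1 := by omega
      clear hnext v'
      replace h := q8 h (by omega)
      replace h' := q8 h' (by omega)
      left; omega
    · refine ⟨4, Or.inr (Chord.mkE (i := i) (j := j) ?_)⟩
      iterate 3 right
      have hx : i' = i ∧ j' = j + 1 := by omega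
      clear hnext v'
      replace h := q5 h (by omega)
      replace h' := q5 h' (by omega)
      left; omega
  · by_cases hib : i = b
    · refine ⟨1, Or.inr (Chord.mkB (i := i) (j := j) ?_)⟩
      iterate 4 right
      have hx : i' = 0 ∧ j' = 0 := by omega
      clear hnext v'
      replace h := q8 h (by omega)
      unfold IsPos at h'
      left; omega
    · refine ⟨1, Or.inr (Chord.mkB (i := i) (j := j) ?_)⟩
      iterate 2 right
      have hx : i' = i ∧ j' = j + 1 := by omega
      clear hnext v'
      replace h := q5 h (by omega)
      replace h' := q6 h' (by omega)
      left; omega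

set_option maxHeartbeats 2000000 in
/-- edges `x → x + k` -/
theorem edge_k {b k r i j i' j' a p a' p' : ℕ} (hb : b % 2 = 0) (hb2 : 2 ≤ b)
    (hr : r % 2 = 1) (hr3 : 3 ≤ r) (hrk : r + 2 ≤ k) (v : Valid b k r i j)
    (v' : Valid b k r i' j')
    (hnext : (i' = i + 1 ∧ j' = j) ∨ (i + 1 = b ∧ r ≤ j ∧ i' = 0 ∧ j' + r = j) ∨
      (i = b ∧ i' = 0 ∧ j' + r = k + j))
    (h : IsPos b k r i j a p) (h' : IsPos b k r i' j' a' p') : Edge b k r a p a' p' := by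
  unfold Valid at v v'
  unfold Edge
  rcases Nat.lt_or_ge (i + 1) b with hi | hi
  · rcases Nat.mod_two_eq_zero_or_one i with he | he
    · by_cases j0 : j = 0
      · refine ⟨0, Or.inl (Chord.mkA (i := i) (j := k) ?_)⟩
        have hx : i' = i + 1 ∧ j' = j := by omega
        clear hnext v'
        replace h := q1 h (by omega)
        unfold IsPos at h'
        unfold ChA; omega
      · refine ⟨0, Or.inl (Chord.mkA (i := i) (j := j) ?_)⟩
        have hx : i' = i + 1 ∧ j' = j := by omega
        clear hnext v'
        replace h := q0 h (by omega)
        unfold IsPos at h'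
        unfold ChA; omega
    · by_cases j0 : j = 0
      · refine ⟨1, Or.inl (Chord.mkB (i := i) (j := k) ?_)⟩
        have hx : i' = i + 1 ∧ j' = j := by omega
        clear hnext v'
        replace h := q3 h (by omega)
        replace h' := q1 h' (by omega)
        left; omega
      · refine ⟨1, Or.inl (Chord.mkB (i := i) (j := j) ?_)⟩
        have hx : i' = i + 1 ∧ j' = j := by omega
        clear hnext v'
        replace h := q2 h (by omega)
        replace h' := q0 h' (by omega)
        left; omega
  by_cases hib : i = b
  · by_cases j0 : j = 0
    · refine ⟨4, Or.inr (Chord.mkE (i := i) (j := j) ?_)⟩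
      iterate 7 right
      have hx : i' = 0 ∧ j' + r = k + j := by omega
      clear hnext v'
      replace h := q7 h (by omega)
      unfold IsPos at h'
      omega
    by_cases jr : j + 2 ≤ r
    · refine ⟨1, Or.inr (Chord.mkB (i := i) (j := j) ?_)⟩
      iterate 5 right
      have hx : i' = 0 ∧ j' + r = k + j := by omega
      clear hnext v'
      replace h := q8 h (by omega)
      unfold IsPos at h'
      omega
    · refine ⟨3, Or.inr (Chord.mkD (i := i) (j := j) ?_)⟩
      iterate 9 right
      have hx : i' = 0 ∧ j' + r = k + j := by omega
      clear hnext v'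
      replace h := q8 h (by omega)
      unfold IsPos at h'
      omega
  · by_cases j0 : j = 0
    · refine ⟨3, Or.inl (Chord.mkD (i := i) (j := j) ?_)⟩
      iterate 6 right
      have hx : i' = i + 1 ∧ j' = j := by omega
      clear hnext v'
      replace h := q4 h (by omega)
      replace h' := q7 h' (by omega)
      left; omega
    by_cases jr : j + 3 ≤ r
    · rcases Nat.mod_two_eq_zero_or_one j with hj | hj
      · refine ⟨4, Or.inl (Chord.mkE (i := i) (j := j) ?_)⟩
        iterate 5 right
        have hx : i' = i + 1 ∧ j' = j := by omega
        clear hnext v'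
        replace h := q5 h (by omega)
        replace h' := q8 h' (by omega)
        left; omega
      · refine ⟨4, Or.inr (Chord.mkE (i := i) (j := j) ?_)⟩
        iterate 5 right
        have hx : i' = i + 1 ∧ j' = j := by omega
        clear hnext v'
        replace h := q5 h (by omega)
        replace h' := q8 h' (by omega)
        left; omega
    by_cases jr2 : j + 2 = r
    · refine ⟨3, Or.inr (Chord.mkD (i := i) (j := j) ?_)⟩
      iterate 7 right
      have hx : i' = i + 1 ∧ j' = j := by omega
      clear hnext v'
      replace h := q5 h (by omega)
      replace h' := q8 h' (by omega)
      left; omega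
    by_cases jr1 : j + 1 = r
    · refine ⟨2, Or.inl (Chord.mkC (i := i) (j := j) ?_)⟩
      iterate 9 right
      have hx : i' = i + 1 ∧ j' = j := by omega
      clear hnext v'
      replace h := q5 h (by omega)
      replace h' := q8 h' (by omega)
      omega
    by_cases jr0 : j = r
    · refine ⟨3, Or.inr (Chord.mkD (i := i) (j := j) ?_)⟩
      iterate 8 right
      have hx : i' = 0 ∧ j' + r = j := by omega
      clear hnext v'
      replace h := q6 h (by omega)
      unfold IsPos at h'
      left; omega
    · refine ⟨4, Or.inr (Chord.mkE (i := i) (j := j) ?_)⟩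
      iterate 6 right
      have hx : i' = 0 ∧ j' + r = j := by omega
      clear hnext v'
      replace h := q6 h (by omega)
      unfold IsPos at h'
      left; omega

end MBT

namespace MBT

theorem chord_lt {b k r : ℕ} (hb2 : 2 ≤ b) (hr3 : 3 ≤ r)
    (hrk : r + 2 ≤ k) {c : Fin 5} {li lp hi hp : ℕ}
    (h : Chord b k r c li lp hi hp) : li < hi ∨ (li = hi ∧ lp < hp) := by
  obtain ⟨i, j, h⟩ := h
  rcases h with ⟨rfl, h⟩ | ⟨rfl, h⟩ | ⟨rfl, h⟩ | ⟨rfl, h⟩ | ⟨rfl, h⟩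
  · unfold ChA at h
    omega
  · unfold ChB at h
    rcases h with h | h | h | h | h | h <;> omega
  · unfold ChC at h
    rcases h with h | h | h | h | h | h | h | h | h | h <;> omega
  · unfold ChD at h
    rcases h with h | h | h | h | h | h | h | h | h | h <;> omega
  · unfold ChE at h
    rcases h with h | h | h | h | h | h | h | h <;> omega

theorem hasMBE_order {V : Type*} [LinearOrder V] [Fintype V] (G : SimpleGraph V)
    (Ch : Fin 5 → V → V → Prop)
    (hE : ∀ u v, G.Adj u v → ∃ c, Ch c u v ∨ Ch c v u)
    (hlt : ∀ c u v, Ch c u v → u < v)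
    (hgood : ∀ c u v u' v', Ch c u v → Ch c u' v' → u ≤ u' → u' ≤ v → v ≤ v' →
      u = u' ∧ v = v') : HasMBE G 5 := by
  classical
  have hE' : ∀ u v, G.Adj u v → ∃ c, Ch c (min u v) (max u v) := by
    intro u v h
    obtain ⟨c, hc | hc⟩ := hE u v h
    · have := hlt _ _ _ hc
      refine ⟨c, ?_⟩
      rwa [min_eq_left this.le, max_eq_right this.le]
    · have := hlt _ _ _ hc
      refine ⟨c, ?_⟩
      rwa [min_eq_right this.le, max_eq_left this.le]
  let σ : V ≃o Fin (Nat.card V) :=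
    (Fintype.orderIsoFinOfCardEq V (Nat.card_eq_fintype_card).symm).symm
  let col : V → V → Fin 5 := fun u v =>
    if h : ∃ c, Ch c (min u v) (max u v) then h.choose else 0
  have hcol : ∀ u v, G.Adj u v → Ch (col u v) (min u v) (max u v) := by
    intro u v h
    have h1 := hE' u v h
    simp only [col, dif_pos h1]
    exact h1.choose_spec
  refine ⟨σ.toEquiv, col, ?_, ?_, ?_⟩
  · intro u v _
    simp only [col, min_comm u v, max_comm u v]
  · intro u v w h1 h2 hvw heq
    have c1 := hcol _ _ h1
    have c2 := hcol _ _ h2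
    rw [← heq] at c2
    generalize col u v = c at c1 c2
    have huv := h1.ne
    have huw := h2.ne
    rcases lt_or_gt_of_ne huv with a1 | a1 <;> rcases lt_or_gt_of_ne huw with a2 | a2
    · rw [min_eq_left a1.le, max_eq_right a1.le] at c1
      rw [min_eq_left a2.le, max_eq_right a2.le] at c2
      rcases le_total v w with l | l
      · exact hvw (hgood _ _ _ _ _ c1 c2 le_rfl a1.le l).2
      · exact hvw (hgood _ _ _ _ _ c2 c1 le_rfl a2.le l).2.symm
    · rw [min_eq_left a1.le, max_eq_right a1.le] at c1
      rw [min_eq_right a2.le, max_eq_left a2.le] at c2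
      exact a2.ne (hgood _ _ _ _ _ c2 c1 a2.le le_rfl a1.le).1
    · rw [min_eq_right a1.le, max_eq_left a1.le] at c1
      rw [min_eq_left a2.le, max_eq_right a2.le] at c2
      exact a1.ne (hgood _ _ _ _ _ c1 c2 a1.le le_rfl a2.le).1
    · rw [min_eq_right a1.le, max_eq_left a1.le] at c1
      rw [min_eq_right a2.le, max_eq_left a2.le] at c2
      rcases le_total v w with l | l
      · exact hvw (hgood _ _ _ _ _ c1 c2 l a2.le le_rfl).1
      · exact hvw (hgood _ _ _ _ _ c2 c1 l a1.le le_rfl).1.symm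
  · intro a b c d h1 h2 hx heq
    have c1 := hcol _ _ h1
    have c2 := hcol _ _ h2
    rw [← heq] at c2
    generalize col a b = e at c1 c2
    have hB : ∀ x, ChordBetween (σ x) (σ a) (σ b) ↔ min a b < x ∧ x < max a b := by
      intro x
      unfold ChordBetween
      rw [← σ.map_inf, ← σ.map_sup]
      simp only [OrderIso.lt_iff_lt]
    have hx' : Xor (min a b < c ∧ c < max a b) (min a b < d ∧ d < max a b) := by
      have : Xor (ChordBetween (σ c) (σ a) (σ b)) (ChordBetween (σ d) (σ a) (σ b)) := hx
      rwa [hB, hB] at this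
    have hm := hlt _ _ _ c1
    have hm2 := hlt _ _ _ c2
    generalize min a b = l at *
    generalize max a b = u at *
    have hx2 : Xor (l < min c d ∧ min c d < u) (l < max c d ∧ max c d < u) := by
      rcases le_total c d with hcd | hcd
      · rwa [min_eq_left hcd, max_eq_right hcd]
      · rw [min_eq_right hcd, max_eq_left hcd, _root_.xor_comm]
        exact hx'
    generalize min c d = l' at *
    generalize max c d = u' at *
    rcases hx2 with ⟨⟨p1, p2⟩, p3⟩ | ⟨⟨p1, p2⟩, p3⟩
    · have : u ≤ u' := by
        by_contra hh
        exact p3 ⟨p1.trans hm2, not_le.1 hh⟩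
      exact p1.ne (hgood _ _ _ _ _ c1 c2 p1.le p2.le this).1
    · have : l' ≤ l := by
        by_contra hh
        exact p3 ⟨not_le.1 hh, hm2.trans p2⟩
      exact p2.ne (hgood _ _ _ _ _ c2 c1 this p1.le p2.le).2

theorem circ_adj {n k : ℕ} {u v : ZMod n} : (circ n k).Adj u v ↔
    u ≠ v ∧ (v = u + 1 ∨ v = u + k ∨ u = v + 1 ∨ u = v + k) := by
  unfold circ circulant
  simp only [SimpleGraph.fromRel_adj, Set.mem_insert_iff, Set.mem_singleton_iff, exists_eq_or_imp,
    exists_eq_left, Int.cast_one, Int.cast_natCast, sub_eq_iff_eq_add, add_comm (1 : ZMod n),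
    add_comm (k : ZMod n)]
  tauto

theorem dm {k i j x : ℕ} (h : x = k * i + j) (hj : j < k) : x / k = i ∧ x % k = j :=
  (Nat.div_mod_unique (by omega)).2 ⟨by omega, hj⟩

theorem valid_of_lt {b k r x : ℕ} (hrk : r + 2 ≤ k) (hx : x < b * k + r) :
    Valid b k r (x / k) (x % k) := by
  have h1 := Nat.div_add_mod x k
  have h2 : x % k < k := Nat.mod_lt _ (by omega)
  unfold Valid
  generalize x / k = i at *
  generalize x % k = j at *
  rcases lt_trichotomy i b with h | h | h
  · exact Or.inl ⟨h, h2⟩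
  · subst h
    right
    refine ⟨rfl, ?_⟩
    rw [mul_comm] at h1
    omega
  · exfalso
    have : k * (b + 1) ≤ k * i := Nat.mul_le_mul_left _ h
    rw [mul_add, mul_comm k b] at this
    omega

theorem next_one {b k r n x : ℕ} (hn : n = b * k + r) (hrk : r + 2 ≤ k) (hr3 : 3 ≤ r)
    (hx : x < n) (i j i' j' : ℕ) (hi : i = x / k) (hj : j = x % k)
    (hi' : i' = ((x + 1) % n) / k) (hj' : j' = ((x + 1) % n) % k) :
    (i' = i ∧ j' = j + 1) ∨ (j + 1 = k ∧ i < b ∧ i' = i + 1 ∧ j' = 0) ∨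
      (i = b ∧ j + 1 = r ∧ i' = 0 ∧ j' = 0) := by
  have h1 := Nat.div_add_mod x k
  have h2 : x % k < k := Nat.mod_lt _ (by omega)
  have hv := valid_of_lt hrk (hn ▸ hx)
  unfold Valid at hv
  rw [← hi, ← hj] at h1 hv
  rw [← hj] at h2
  by_cases e : x + 1 = n
  · have h0 : (x + 1) % n = 0 := by rw [e, Nat.mod_self]
    rw [h0] at hi' hj'
    simp at hi' hj'
    right; right
    have : x / k = b ∧ x % k = r - 1 := by
      refine dm ?_ (by omega)
      rw [mul_comm k b]
      omega
    omega
  · rw [Nat.mod_eq_of_lt (by omega : x + 1 < n)] at hi' hj'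
    by_cases e2 : j + 1 = k
    · have := dm (x := x + 1) (k := k) (i := i + 1) (j := 0) (by rw [mul_add]; omega) (by omega)
      omega
    · have := dm (x := x + 1) (k := k) (i := i) (j := j + 1) (by omega) (by omega)
      omega

theorem next_k {b k r n x : ℕ} (hn : n = b * k + r) (hrk : r + 2 ≤ k) (hr3 : 3 ≤ r)
    (hb2 : 2 ≤ b) (hx : x < n) (i j i' j' : ℕ) (hi : i = x / k) (hj : j = x % k)
    (hi' : i' = ((x + k) % n) / k) (hj' : j' = ((x + k) % n) % k) :
    (i' = i + 1 ∧ j' = j) ∨ (i + 1 = b ∧ r ≤ j ∧ i' = 0 ∧ j' + r = j) ∨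
      (i = b ∧ i' = 0 ∧ j' + r = k + j) := by
  have h1 := Nat.div_add_mod x k
  have h2 : x % k < k := Nat.mod_lt _ (by omega)
  have hv := valid_of_lt hrk (hn ▸ hx)
  unfold Valid at hv
  rw [← hi, ← hj] at h1 hv
  rw [← hj] at h2
  have hkn : k < n := by nlinarith
  by_cases e : x + k < n
  · rw [Nat.mod_eq_of_lt e] at hi' hj'
    have := dm (x := x + k) (k := k) (i := i + 1) (j := j) (by rw [mul_add]; omega) (by omega)
    omega
  · have h0 : (x + k) % n = x + k - n := by
      rw [Nat.mod_eq_sub_mod (by omega), Nat.mod_eq_of_lt (by omega)]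
    rw [h0] at hi' hj'
    rcases lt_trichotomy (i + 1) b with h | h | h
    · exfalso
      have : (i + 2) * k ≤ b * k := Nat.mul_le_mul_right _ h
      have h3 : (i + 2) * k = k * i + 2 * k := by ring
      omega
    · have h3 : n = k * i + k + r := by rw [hn, ← h]; ring
      have := dm (x := x + k - n) (k := k) (i := 0) (j := j - r) (by omega) (by omega)
      omega
    · have h4 : i = b := by omega
      have h3 : n = k * i + r := by rw [hn, h4]; ring
      have := dm (x := x + k - n) (k := k) (i := 0) (j := k + j - r) (by omega) (by omega)
      omega

theorem edge_symm {b k r a p a' p' : ℕ} (h : Edge b k r a p a' p') : Edge b k r a' p' a p := by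
  obtain ⟨c, h⟩ := h
  exact ⟨c, h.symm⟩

theorem hasMBE_core {b k r n : ℕ} (hn : n = b * k + r) (hb : b % 2 = 0) (hb2 : 2 ≤ b)
    (hr : r % 2 = 1) (hr3 : 3 ≤ r) (hrk : r + 2 ≤ k) : HasMBE (circ n k) 5 := by
  have : NeZero n := ⟨by omega⟩
  have hkn : k < n := by nlinarith
  have hV : ∀ x : ZMod n, Valid b k r (x.val / k) (x.val % k) := fun x =>
    valid_of_lt hrk (hn ▸ ZMod.val_lt x)
  have hP := fun x : ZMod n => isPos_exists hb2 hrk (hV x)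
  choose A P hAP using hP
  let f : ZMod n → ℕ ×ₗ ℕ := fun x => toLex (A x, P x)
  have hf : Function.Injective f := by
    intro x y hxy
    have h1 : (A x, P x) = (A y, P y) := toLex.injective hxy
    simp only [Prod.mk.injEq] at h1
    have hx := hAP x
    rw [h1.1, h1.2] at hx
    have := isPos_inj hb2 hrk (hV x) (hV y) hx (hAP y)
    apply ZMod.val_injective
    rw [← Nat.div_add_mod x.val k, ← Nat.div_add_mod y.val k, this.1, this.2]
  let _ : LinearOrder (ZMod n) := LinearOrder.lift' f hf
  have hle : ∀ x y : ZMod n, x ≤ y ↔ LE2 (A x) (P x) (A y) (P y) := by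
    intro x y
    have : x ≤ y ↔ f x ≤ f y := Iff.rfl
    rw [this, Prod.Lex.le_iff]
    rfl
  have hone : ∀ u : ZMod n, Edge b k r (A u) (P u) (A (u + 1)) (P (u + 1)) := by
    intro u
    refine edge_one hb hb2 hr hr3 hrk (hV u) (hV (u + 1)) ?_ (hAP u) (hAP (u + 1))
    have : (u + 1).val = (u.val + 1) % n := by
      rw [ZMod.val_add, ZMod.val_one'' (by omega)]
    exact next_one hn hrk hr3 (ZMod.val_lt u) _ _ _ _ rfl rfl (by rw [this]) (by rw [this])
  have hkk : ∀ u : ZMod n, Edge b k r (A u) (P u) (A (u + k)) (P (u + k)) := by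
    intro u
    refine edge_k hb hb2 hr hr3 hrk (hV u) (hV (u + k)) ?_ (hAP u) (hAP (u + k))
    have : (u + k).val = (u.val + k) % n := by
      rw [ZMod.val_add, ZMod.val_natCast_of_lt hkn]
    exact next_k hn hrk hr3 hb2 (ZMod.val_lt u) _ _ _ _ rfl rfl (by rw [this]) (by rw [this])
  refine hasMBE_order (circ n k) (fun c u v => Chord b k r c (A u) (P u) (A v) (P v)) ?_ ?_ ?_
  · intro u v h
    rw [circ_adj] at h
    rcases h.2 with rfl | rfl | rfl | rfl
    · exact hone u
    · exact hkk u
    · exact edge_symm (hone v)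
    · exact edge_symm (hkk v)
  · intro c u v h
    have h1 := chord_lt hb2 hr3 hrk h
    rw [← not_le, hle]
    unfold LE2
    omega
  · intro c u v u' v' h h' h1 h2 h3
    have := chord_good hb hb2 hr hr3 hrk h h' ((hle _ _).1 h1) ((hle _ _).1 h2) ((hle _ _).1 h3)
    constructor
    · apply hf
      simp only [f, this.1, this.2.1]
    · apply hf
      simp only [f, this.2.2.1, this.2.2.2]

theorem hasMBE_transfer {V : Type*} {G H : SimpleGraph V} {m : ℕ} (e : V ≃ V)
    (he : ∀ u v, G.Adj u v → H.Adj (e u) (e v)) (h : HasMBE H m) : HasMBE G m := by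
  obtain ⟨σ, col, h1, h2, h3⟩ := h
  refine ⟨e.trans σ, fun u v => col (e u) (e v), ?_, ?_, ?_⟩
  · intro u v h
    exact h1 _ _ (he _ _ h)
  · intro u v w h h' hne
    exact h2 _ _ _ (he _ _ h) (he _ _ h') (fun hh => hne (e.injective hh))
  · intro a b c d h h' hc
    exact h3 _ _ _ _ (he _ _ h) (he _ _ h') hc

/-- the graph `C(n,k)` maps to `C(n,κ)` by multiplication by `κ = ± k⁻¹` -/
theorem hasMBE_circ {n k κ m : ℕ} (hk : (k : ZMod n) * κ = 1 ∨ (k : ZMod n) * κ = -1)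
    (h : HasMBE (circ n κ) m) : HasMBE (circ n k) m := by
  have hu : IsUnit (κ : ZMod n) := by
    rcases hk with h | h
    · exact IsUnit.of_mul_eq_one (k : ZMod n) (by rw [mul_comm]; exact h)
    · exact IsUnit.of_mul_eq_one (-(k : ZMod n)) (by rw [mul_comm, neg_mul, h, neg_neg])
  obtain ⟨w, hw⟩ := hu
  have hinj : Function.Injective (fun x : ZMod n => x * κ) := by
    intro x y hxy
    rw [← hw] at hxy
    simpa using hxy
  refine hasMBE_transfer (Units.mulRight w) ?_ h
  intro u v
  rw [circ_adj, circ_adj]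
  simp only [Units.mulRight_apply, hw]
  rintro ⟨h1, h2⟩
  refine ⟨fun hh => h1 (hinj hh), ?_⟩
  rcases h2 with rfl | rfl | rfl | rfl
  · right; left; ring
  · rcases hk with h | h
    · left; rw [add_mul, h]
    · right; right; left; rw [add_mul, h]; ring
  · right; right; right; ring
  · rcases hk with h | h
    · right; right; left; rw [add_mul, h]
    · left; rw [add_mul, h]; ring

end MBT

namespace MBT

theorem cast_ne_zero {n x : ℕ} (h0 : 0 < x) (h1 : x < n) : (x : ZMod n) ≠ 0 := by
  intro h
  rw [ZMod.natCast_eq_zero_iff] at h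
  exact absurd (Nat.le_of_dvd h0 h) (by omega)

theorem neighborSet_circ {n k : ℕ} (hk : 2 ≤ k) (hkn : 2 * k < n) (v : ZMod n) :
    (circ n k).neighborSet v = {v + 1, v + k, v - 1, v - k} := by
  have h1 := cast_ne_zero (n := n) (x := 1) (by omega) (by omega)
  have h2 := cast_ne_zero (n := n) (x := k) (by omega) (by omega)
  push_cast at h1
  ext w
  simp only [SimpleGraph.mem_neighborSet, circ_adj, Set.mem_insert_iff, Set.mem_singleton_iff,
    eq_sub_iff_add_eq]
  constructor
  · rintro ⟨_, h | h | h | h⟩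
    · exact Or.inl h
    · exact Or.inr (Or.inl h)
    · exact Or.inr (Or.inr (Or.inl h.symm))
    · exact Or.inr (Or.inr (Or.inr h.symm))
  · intro h
    constructor
    · rintro rfl
      simp [h1, h2] at h
    · rcases h with h | h | h | h
      · exact Or.inl h
      · exact Or.inr (Or.inl h)
      · exact Or.inr (Or.inr (Or.inl h.symm))
      · exact Or.inr (Or.inr (Or.inr h.symm))

theorem ncard_nbr {n k : ℕ} (hk : 2 ≤ k) (hkn : 2 * k < n) (v : ZMod n) :
    ((circ n k).neighborSet v).ncard = 4 := by
  rw [neighborSet_circ hk hkn]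
  have a1 := cast_ne_zero (n := n) (x := 2) (by omega) (by omega)
  have a2 := cast_ne_zero (n := n) (x := k - 1) (by omega) (by omega)
  have a3 := cast_ne_zero (n := n) (x := k + 1) (by omega) (by omega)
  have a4 := cast_ne_zero (n := n) (x := 2 * k) (by omega) (by omega)
  rw [Nat.cast_sub (by omega)] at a2
  push_cast at a1 a2 a3 a4
  rw [Set.ncard_insert_of_notMem, Set.ncard_insert_of_notMem, Set.ncard_pair]
  · intro h
    apply a2
    linear_combination h
  · simp only [Set.mem_insert_iff, Set.mem_singleton_iff]
    rintro (h | h)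
    · apply a3
      linear_combination h
    · apply a4
      linear_combination h
  · simp only [Set.mem_insert_iff, Set.mem_singleton_iff]
    rintro (h | h | h)
    · apply a2
      linear_combination -h
    · apply a1
      linear_combination h
    · apply a3
      linear_combination h

theorem maxDeg_circ {n k : ℕ} (hk : 2 ≤ k) (hkn : 2 * k < n) : maxDeg (circ n k) = 4 := by
  unfold maxDeg
  simp only [ncard_nbr hk hkn, Set.range_const, csSup_singleton]

theorem lower {V : Type*} [Fintype V] (G : SimpleGraph V) (hodd : Odd (Fintype.card V))
    (hdeg : ∀ v, (G.neighborSet v).ncard = 4) {m : ℕ} (h : HasMBE G m) : 5 ≤ m := by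
  classical
  obtain ⟨σ, col, hs, hp, -⟩ := h
  have hinj : ∀ v, Set.InjOn (col v) (G.neighborSet v) := by
    intro v x hx y hy hxy
    by_contra hne
    exact hp v x y hx hy hne hxy
  have himg : ∀ v, (col v '' G.neighborSet v).ncard = 4 := by
    intro v
    rw [(hinj v).ncard_image, hdeg]
  have hle : ∀ _v : V, 4 ≤ m := by
    intro v
    rw [← himg v]
    calc _ ≤ (Set.univ : Set (Fin m)).ncard := Set.ncard_le_ncard (Set.subset_univ _)
      _ = m := by simp [Set.ncard_univ]
  have hne : Nonempty V := by
    apply Fintype.card_pos_iff.1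
    exact hodd.pos
  by_contra hlt
  have hm : m = 4 := by
    have := hle hne.some
    omega
  subst hm
  have hsurj : ∀ v, ∃ w, G.Adj v w ∧ col v w = 0 := by
    intro v
    have : col v '' G.neighborSet v = Set.univ := by
      apply Set.eq_of_subset_of_ncard_le (Set.subset_univ _)
      rw [himg v]
      simp [Set.ncard_univ]
    have h0 : (0 : Fin 4) ∈ col v '' G.neighborSet v := by
      rw [this]
      trivial
    obtain ⟨w, hw, h⟩ := h0
    exact ⟨w, hw, h⟩
  choose g hg1 hg2 using hsurj
  have hgg : ∀ v, g (g v) = v := by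
    intro v
    by_contra hne
    refine hp (g v) (g (g v)) v (hg1 _) (hg1 v).symm hne ?_
    rw [hg2, ← hs _ _ (hg1 v), hg2]
  have hsum : ∑ _x : V, (1 : ZMod 2) = 0 := by
    refine Finset.sum_involution (fun v _ => g v) ?_ ?_ ?_ ?_
    · intro v _
      decide
    · intro v _ _
      exact (hg1 v).ne'
    · intro v _
      exact Finset.mem_univ _
    · intro v _
      exact hgg v
  simp at hsum
  rw [ZMod.natCast_eq_zero_iff] at hsum
  exact (Nat.not_even_iff_odd.2 hodd) (even_iff_two_dvd.2 hsum)

theorem final {n k κ b ρ : ℕ} (hodd : Odd n) (hk : 4 ≤ k) (hk' : k ≤ n / 2)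
    (hκ : (k : ZMod n) * κ = 1 ∨ (k : ZMod n) * κ = -1)
    (hn : n = b * κ + ρ) (hb : b % 2 = 0) (hb2 : 2 ≤ b)
    (hr : ρ % 2 = 1) (hr3 : 3 ≤ ρ) (hrk : ρ + 2 ≤ κ) :
    mbt (circ n k) = maxDeg (circ n k) + 1 ∧ maxDeg (circ n k) + 1 = 5 := by
  have h2k : 2 * k < n := by
    obtain ⟨q, hq⟩ := hodd
    omega
  rw [maxDeg_circ (by omega) h2k]
  refine ⟨?_, rfl⟩
  have : NeZero n := ⟨by omega⟩
  have hm : HasMBE (circ n k) 5 := hasMBE_circ hκ (hasMBE_core hn hb hb2 hr hr3 hrk)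
  unfold mbt
  apply le_antisymm
  · exact Nat.sInf_le hm
  · have h0 : HasMBE (circ n k) (sInf {m | HasMBE (circ n k) m}) :=
      Nat.sInf_mem (s := {m | HasMBE (circ n k) m}) ⟨5, hm⟩
    refine lower (circ n k) ?_ (ncard_nbr (by omega) h2k) h0
    rwa [ZMod.card]

end MBT

namespace MBT

theorem seq_facts {n k a r m : ℕ} (hgcd : Nat.gcd n k = 1) (hn : n = a * k + r)
    (hr : 2 ≤ r) (hr' : r + 2 ≤ k)
    (hmmin : ∀ m' < m, (euclidSeq k r (m' + 1)).2 ≠ 0) :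
    ∀ i, i ≤ m → 0 < (euclidSeq k r i).2 ∧ (euclidSeq k r i).2 < (euclidSeq k r i).1 ∧
      Nat.Coprime (euclidSeq k r i).1 (euclidSeq k r (i + 1)).1 := by
  intro i
  induction i with
  | zero =>
    intro _
    have e1 : (euclidSeq k r 0).1 = k := rfl
    have e2 : (euclidSeq k r 0).2 = r := rfl
    have e3 : (euclidSeq k r (0 + 1)).1 = k - r := rfl
    rw [e1, e2, e3]
    refine ⟨by omega, by omega, ?_⟩
    have h1 : Nat.Coprime k r := by
      have h2 : Nat.Coprime k n := by rw [Nat.coprime_comm]; exact hgcd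
      rw [hn] at h2
      simpa using h2
    have h2 : Nat.Coprime k (k - r) := (Nat.coprime_self_sub_right (by omega)).2 h1
    exact h2
  | succ i ih =>
    intro hi
    obtain ⟨h1, h2, h3⟩ := ih (by omega)
    have h4 := hmmin i (by omega)
    have e1 : (euclidSeq k r (i + 1)).1 = (euclidSeq k r i).1 - (euclidSeq k r i).2 := rfl
    have e2 : (euclidSeq k r (i + 1)).2 =
      (euclidSeq k r i).1 % (euclidSeq k r (i + 1)).1 := rfl
    have e3 : (euclidSeq k r (i + 1 + 1)).1 =
      (euclidSeq k r (i + 1)).1 - (euclidSeq k r (i + 1)).2 := rfl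
    have h5 : (euclidSeq k r (i + 1)).2 < (euclidSeq k r (i + 1)).1 := by
      rw [e2]
      exact Nat.mod_lt _ (by omega)
    refine ⟨by omega, h5, ?_⟩
    rw [e3]
    apply (Nat.coprime_self_sub_right h5.le).2
    rw [e2]
    unfold Nat.Coprime at *
    rw [Nat.gcd_comm, ← Nat.gcd_rec, Nat.gcd_comm]
    exact h3

theorem seq_inv {n k a r m : ℕ} (hk' : 2 * k ≤ n) (hgcd : Nat.gcd n k = 1) (hn : n = a * k + r)
    (hr : 2 ≤ r) (hr' : r + 2 ≤ k)
    (hmmin : ∀ m' < m, (euclidSeq k r (m' + 1)).2 ≠ 0) :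
    ∀ i, i ≤ m → ∃ y y' : ℕ, 0 < y ∧ y < y' ∧
      (euclidSeq k r i).1 * y' = n + (euclidSeq k r (i + 1)).1 * y ∧
      (k : ZMod n) * y = ((euclidSeq k r i).1 : ℕ) ∧
      (k : ZMod n) * y' = ((euclidSeq k r (i + 1)).1 : ℕ) ∧
      (2 * y < y' ∨ ∃ i', i = i' + 1 ∧
        (euclidSeq k r i').1 = (euclidSeq k r i).1 + (euclidSeq k r i).2) := by
  have hF := seq_facts hgcd hn hr hr' hmmin
  intro i
  induction i with
  | zero =>
    intro _
    have e1 : (euclidSeq k r 0).1 = k := rfl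
    have e3 : (euclidSeq k r (0 + 1)).1 = k - r := rfl
    rw [e1, e3]
    have ha : 2 ≤ a := by
      by_contra h
      have : a * k ≤ 1 * k := Nat.mul_le_mul_right _ (by omega)
      omega
    have hdet : k * (a + 1) = n + (k - r) := by
      rw [hn, mul_add, mul_comm k a]
      omega
    refine ⟨1, a + 1, by omega, by omega, by omega, by simp, ?_, Or.inl (by omega)⟩
    have := congrArg (Nat.cast : ℕ → ZMod n) hdet
    rw [Nat.cast_mul, Nat.cast_add n, ZMod.natCast_self, zero_add] at this
    exact this
  | succ i ih =>
    intro hi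
    obtain ⟨y, y', h1, h2, h3, h4, h5, -⟩ := ih (by omega)
    obtain ⟨f1, f2, -⟩ := hF i (by omega)
    obtain ⟨g1, g2, -⟩ := hF (i + 1) hi
    have e1 : (euclidSeq k r (i + 1)).1 = (euclidSeq k r i).1 - (euclidSeq k r i).2 := rfl
    have e2 : (euclidSeq k r (i + 1)).2 =
      (euclidSeq k r i).1 % (euclidSeq k r (i + 1)).1 := rfl
    have e3 : (euclidSeq k r (i + 1 + 1)).1 =
      (euclidSeq k r (i + 1)).1 - (euclidSeq k r (i + 1)).2 := rfl
    have hdm := Nat.div_add_mod (euclidSeq k r i).1 (euclidSeq k r (i + 1)).1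
    rw [← e2] at hdm
    have hq : 1 ≤ (euclidSeq k r i).1 / (euclidSeq k r (i + 1)).1 :=
      Nat.div_pos (by omega) (by omega)
    generalize (euclidSeq k r i).1 / (euclidSeq k r (i + 1)).1 = q at *
    generalize hK0 : (euclidSeq k r i).1 = K0 at *
    generalize hK1 : (euclidSeq k r (i + 1)).1 = K1 at *
    generalize hK2 : (euclidSeq k r (i + 1 + 1)).1 = K2 at *
    generalize hR1 : (euclidSeq k r (i + 1)).2 = R1 at *
    have hc : (q + 1) * K1 = K0 + K2 := by
      rw [add_mul, mul_comm q]
      omega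
    obtain ⟨z, hz⟩ : ∃ z, z + y = (q + 1) * y' := by
      refine ⟨(q + 1) * y' - y, ?_⟩
      have : 1 * y' ≤ (q + 1) * y' := Nat.mul_le_mul_right _ (by omega)
      omega
    refine ⟨y', z, by omega, ?_, ?_, h5, ?_, ?_⟩
    · have : 2 * y' ≤ (q + 1) * y' := Nat.mul_le_mul_right _ (by omega)
      omega
    · have h6 : K1 * z + K1 * y = K0 * y' + K2 * y' := by
        rw [← mul_add, hz, ← add_mul, ← hc]
        ring
      omega
    · have hz' := congrArg (Nat.cast : ℕ → ZMod n) hz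
      have hc' := congrArg (Nat.cast : ℕ → ZMod n) hc
      push_cast at hz' hc'
      linear_combination (k : ZMod n) * hz' + hc' + (q + 1 : ZMod n) * h5 - h4
    · rcases Nat.lt_or_ge q 2 with hq2 | hq2
      · right
        refine ⟨i, rfl, ?_⟩
        have : q = 1 := by omega
        subst this
        omega
      · left
        have : 3 * y' ≤ (q + 1) * y' := Nat.mul_le_mul_right _ (by omega)
        omega

theorem arith (n k a r : ℕ) (hk' : 2 * k ≤ n)
    (hgcd : Nat.gcd n k = 1) (hn : n = a * k + r) (hr : 2 ≤ r) (hr' : r + 2 ≤ k)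
    (m : ℕ) (hm : (euclidSeq k r (m + 1)).2 = 0)
    (hmmin : ∀ m' < m, (euclidSeq k r (m' + 1)).2 ≠ 0)
    (t : ℕ)
    (ht1 : ∀ s : ℕ, 0 < s → s < m → 3 ≤ (euclidSeq k r s).1 → (euclidSeq k r s).2 = 1 →
      (∀ s' : ℕ, 0 < s' → s' < s →
        ¬(3 ≤ (euclidSeq k r s').1 ∧ (euclidSeq k r s').2 = 1)) →
      t = (euclidSeq k r s).1 + 1)
    (ht2 : (¬ ∃ s : ℕ, 0 < s ∧ s < m ∧ 3 ≤ (euclidSeq k r s).1 ∧ (euclidSeq k r s).2 = 1) →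
      t = (euclidSeq k r m).1) :
    ∃ κ b ρ : ℕ, ((k : ZMod n) * κ = 1 ∨ (k : ZMod n) * κ = -1) ∧ n = b * κ + ρ ∧ t = b + 1 ∧
      0 < ρ ∧ ρ < κ := by
  have hF := seq_facts hgcd hn hr hr' hmmin
  have hI := seq_inv hk' hgcd hn hr hr' hmmin
  by_cases hs : ∃ s : ℕ, 0 < s ∧ s < m ∧ 3 ≤ (euclidSeq k r s).1 ∧ (euclidSeq k r s).2 = 1
  · classical
    obtain ⟨p1, p2, p3, p4⟩ := Nat.find_spec hs
    have hmin := fun s' => Nat.find_min hs (m := s')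
    generalize Nat.find hs = s at *
    have htt := ht1 s p1 p2 p3 p4 (fun s' q1 q2 q3 => hmin s' q2 ⟨q1, by omega, q3.1, q3.2⟩)
    obtain ⟨y, y', h1, h2, h3, h4, h5, h6⟩ := hI s p2.le
    have e1 : (euclidSeq k r (s + 1)).1 = (euclidSeq k r s).1 - (euclidSeq k r s).2 := rfl
    have h7 : 2 * y < y' := by
      rcases h6 with h6 | ⟨i', rfl, h6⟩
      · exact h6
      · exfalso
        have e2 : (euclidSeq k r (i' + 1)).1 = (euclidSeq k r i').1 - (euclidSeq k r i').2 := rfl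
        obtain ⟨f1, f2, -⟩ := hF i' (by omega)
        have hR : (euclidSeq k r i').2 = 1 := by omega
        rcases Nat.eq_zero_or_pos i' with h0 | h0
        · subst h0
          have : (euclidSeq k r 0).2 = r := rfl
          omega
        · exact hmin i' (by omega) ⟨h0, by omega, by omega, hR⟩
    rw [e1, p4] at h3 h5
    refine ⟨y' - y, (euclidSeq k r s).1, y, Or.inr ?_, ?_, htt, h1, by omega⟩
    · rw [Nat.cast_sub h2.le, mul_sub, h4, h5, Nat.cast_sub (by omega)]
      push_cast
      ring
    · generalize (euclidSeq k r s).1 = K at *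
      have hK : K * (y' - y) + K * y = K * y' := by
        rw [← Nat.mul_add]
        congr 1
        omega
      have hK2 : (K - 1) * y + y = K * y := by
        rw [← Nat.succ_mul]
        congr 1
        omega
      omega
  · have htt := ht2 hs
    obtain ⟨f1, f2, f3⟩ := hF m le_rfl
    obtain ⟨y, y', h1, h2, h3, h4, h5, -⟩ := hI m le_rfl
    have e2 : (euclidSeq k r (m + 1)).2 =
      (euclidSeq k r m).1 % (euclidSeq k r (m + 1)).1 := rfl
    have hK : (euclidSeq k r (m + 1)).1 = 1 := by
      rw [hm] at e2
      have := Nat.dvd_of_mod_eq_zero e2.symm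
      exact Nat.eq_one_of_dvd_coprimes f3 this dvd_rfl
    rw [hK] at h3 h5
    refine ⟨y', (euclidSeq k r m).1 - 1, y' - y, Or.inl ?_, ?_, by omega, by omega, by omega⟩
    · rw [h5]
      simp
    · generalize (euclidSeq k r m).1 = K at *
      rw [Nat.sub_mul, h3]
      have : 1 * y' ≤ K * y' := Nat.mul_le_mul_right _ (by omega)
      omega

theorem nat_eq_of_cast {n x y : ℕ} (hx : x < n) (hy : y < n) (h : (x : ZMod n) = y) : x = y := by
  rw [ZMod.natCast_eq_natCast_iff'] at h
  rwa [Nat.mod_eq_of_lt hx, Nat.mod_eq_of_lt hy] at h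

theorem no_neg {n x y : ℕ} (hx : 0 < x) (hy : x + y < n) (h : (x : ZMod n) = -y) : False := by
  have h1 : ((x + y : ℕ) : ZMod n) = 0 := by
    push_cast
    rw [h]
    ring
  rw [ZMod.natCast_eq_zero_iff] at h1
  exact absurd (Nat.le_of_dvd (by omega) h1) (by omega)

theorem arith2 (n k a r κ b ρ : ℕ) (hodd : n % 2 = 1) (hk' : 2 * k < n)
    (hn : n = a * k + r) (hr : 2 ≤ r) (hr' : r + 2 ≤ k)
    (hκ : (k : ZMod n) * κ = 1 ∨ (k : ZMod n) * κ = -1) (hb : n = b * κ + ρ)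
    (hbe : b % 2 = 0) (hb2 : 2 ≤ b) (h0 : 0 < ρ) (h1 : ρ < κ) :
    ρ % 2 = 1 ∧ 3 ≤ ρ ∧ ρ + 2 ≤ κ := by
  have ho : ρ % 2 = 1 := by
    have : (b * κ) % 2 = 0 := by rw [Nat.mul_mod, hbe]; simp
    omega
  have hne1 : ρ ≠ 1 := by
    rintro rfl
    have hbn : 2 * b < n := by
      have : b * 2 ≤ b * κ := Nat.mul_le_mul_left _ (by omega)
      omega
    have hz : ((b : ZMod n)) * κ = -1 := by
      have := congrArg (Nat.cast : ℕ → ZMod n) hb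
      rw [ZMod.natCast_self] at this
      push_cast at this
      linear_combination -this
    have hkb : k = b := by
      rcases hκ with h | h
      · exfalso
        refine no_neg (n := n) (x := k) (y := b) (by omega) (by omega) ?_
        linear_combination (k : ZMod n) * hz - (b : ZMod n) * h
      · refine nat_eq_of_cast (n := n) (by omega) (by omega) ?_
        linear_combination (k : ZMod n) * hz - (b : ZMod n) * h
    subst hkb
    have e1 : n % k = r := by
      rw [hn, Nat.mul_add_mod', Nat.mod_eq_of_lt (by omega)]
    have e2 : n % k = 1 := by
      rw [hb, mul_comm, Nat.mul_add_mod', Nat.mod_eq_of_lt (by omega)]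
    omega
  have h3 : 3 ≤ ρ := by omega
  refine ⟨ho, h3, ?_⟩
  by_contra hcon
  have hρ : κ = ρ + 1 := by omega
  have hmul : (b + 1) * κ = n + 1 := by
    rw [add_mul]
    omega
  have hbn : 2 * (b + 1) ≤ n := by
    have : (b + 1) * 4 ≤ (b + 1) * κ := Nat.mul_le_mul_left _ (by omega)
    omega
  have hz : ((b + 1 : ℕ) : ZMod n) * κ = 1 := by
    have := congrArg (Nat.cast : ℕ → ZMod n) hmul
    rw [Nat.cast_mul, Nat.cast_add n, ZMod.natCast_self] at this
    rw [this]
    simp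
  have hkb : k = b + 1 := by
    rcases hκ with h | h
    · refine nat_eq_of_cast (n := n) (by omega) (by omega) ?_
      linear_combination (-(k : ZMod n)) * hz + ((b + 1 : ℕ) : ZMod n) * h
    · exfalso
      refine no_neg (n := n) (x := k) (y := b + 1) (by omega) (by omega) ?_
      linear_combination (-(k : ZMod n)) * hz + ((b + 1 : ℕ) : ZMod n) * h
  rw [← hkb] at hmul
  have hd : k ∣ n + 1 := ⟨κ, hmul.symm⟩
  rw [hn, add_assoc] at hd
  have hd2 : k ∣ r + 1 := (Nat.dvd_add_right (dvd_mul_left k a)).1 hd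
  exact absurd (Nat.le_of_dvd (by omega) hd2) (by omega)

end MBT

/-- `n` odd, `gcd(n,k) = 1`, `n = a·k + r` with `2 ≤ r ≤ k - 2`; with `t`
defined from the remainder algorithm, if `t` is odd and `t ≥ 3` then
`mbt(C(n,k)) = Δ(C(n,k)) + 1 = 5`. -/
theorem stmt17 (n k a r : ℕ) (hodd : Odd n) (hk : 4 ≤ k) (hk' : k ≤ n / 2)
    (hgcd : Nat.gcd n k = 1) (hn : n = a * k + r) (hr : 2 ≤ r) (hr' : r ≤ k - 2)
    (m : ℕ) (hm : (euclidSeq k r (m + 1)).2 = 0)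
    (hmmin : ∀ m' < m, (euclidSeq k r (m' + 1)).2 ≠ 0)
    (t : ℕ)
    (ht1 : ∀ s : ℕ, 0 < s → s < m → 3 ≤ (euclidSeq k r s).1 → (euclidSeq k r s).2 = 1 →
      (∀ s' : ℕ, 0 < s' → s' < s →
        ¬(3 ≤ (euclidSeq k r s').1 ∧ (euclidSeq k r s').2 = 1)) →
      t = (euclidSeq k r s).1 + 1)
    (ht2 : (¬ ∃ s : ℕ, 0 < s ∧ s < m ∧ 3 ≤ (euclidSeq k r s).1 ∧ (euclidSeq k r s).2 = 1) →
      t = (euclidSeq k r m).1)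
    (htodd : Odd t) (ht3 : 3 ≤ t) :
    mbt (circ n k) = maxDeg (circ n k) + 1 ∧ maxDeg (circ n k) + 1 = 5 := by
  have hn2 : n % 2 = 1 := Nat.odd_iff.1 hodd
  have ht2' : t % 2 = 1 := Nat.odd_iff.1 htodd
  obtain ⟨κ, b, ρ, h1, h2, h3, h4, h5⟩ := MBT.arith n k a r (by omega) hgcd hn hr (by omega)
    m hm hmmin t ht1 ht2
  obtain ⟨g1, g2, g3⟩ := MBT.arith2 n k a r κ b ρ hn2 (by omega) hn hr (by omega) h1 h2
    (by omega) (by omega) h4 h5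
  exact MBT.final hodd hk hk' h1 h2 (by omega) (by omega) g1 g2 g3
end

section
/- Let n be an odd integer and let k be an integer with 4 ≤ k ≤ ⌊n/2⌋ and gcd(n,k) = 1; write n = a·k + r with 2 ≤ r ≤ k − 2. Let t be defined from the remainder algorithm as follows: with k_0 = k, r_0 = r, k_{i+1} = k_i − r_i and r_{i+1} = (k_i mod k_{i+1}), let m be the least nonnegative integer with r_{m+1} = 0 (so k_{m+1} = 1); if there exists a minimal positive integer s < m with k_s ≥ 3 and r_s = 1, set t = k_s + 1, otherwise set t = k_m. If t is even and t ≥ 2, then mbt(C(n,k)) = Δ(C(n,k)) + 1 = 5. -/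
open SimpleGraph

/-- Lexicographic `≤` on pairs of integers. -/
def LX (A B C D : ℤ) : Prop := A < C ∨ (A = C ∧ B ≤ D)

/-- Standing numerical hypotheses. -/
structure Par (a k r : ℤ) : Prop where
  r2 : 2 ≤ r
  rk : r + 2 ≤ k
  a2 : 2 ≤ a
  par : (r % 2 = 0 ∧ k % 2 = 1 ∧ a % 2 = 1) ∨ (r % 2 = 1 ∧ k % 2 = 1 ∧ a % 2 = 0) ∨
    (r % 2 = 1 ∧ k % 2 = 0)

/-- Height of a vertex in its block, up to sign. -/
def PP (q c : ℤ) : ℤ := 2 * q + (c + q + 1) % 2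

/-- Signed end position in a block of sign `s`. -/
def EP (s p B : ℤ) : Prop := (s = 0 ∧ B = p) ∨ (s = 1 ∧ B = -p)

/-- Signed interval in a block of sign `s`. -/
def WN (s lo hi B1 B2 : ℤ) : Prop := (s = 0 ∧ B1 = lo ∧ B2 = hi) ∨ (s = 1 ∧ B1 = -hi ∧ B2 = -lo)

/-- Vertical edge inside a block. -/
def VE (s q B1 B2 : ℤ) : Prop := WN s (2*q) (2*q+3) B1 B2 ∨ WN s (2*q+1) (2*q+2) B1 B2

/-- Edge inside row zero. -/
def R0 (c A1 B1 A2 B2 : ℤ) : Prop := A1 = 0 ∧ A2 = 0 ∧ B1 = c ∧ B2 = c + 1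

def ItH (a k r _s A1 B1 A2 B2 : ℤ) : Prop :=
  (∃ _q c : ℤ, 0 ≤ c ∧ c ≤ k - 3 ∧ c % 2 = 0 ∧ R0 c A1 B1 A2 B2) ∨
  (∃ _q _c : ℤ, A1 = 0 ∧ B1 = k - 1 ∧ A2 = k ∧ B2 = - 2) ∨
  (∃ q _c : ℤ, 1 ≤ q ∧ q ≤ a - 1 ∧
    ((k % 2 = 1 ∧ r % 2 = 1 ∧ A1 = 2) ∨ (¬ (k % 2 = 1 ∧ r % 2 = 1) ∧ A1 = 1)) ∧
    B1 = PP q (k-1) ∧ A2 = k ∧ B2 = - PP (q+1) 0) ∨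
  (∃ q j : ℤ, 1 ≤ q ∧ q ≤ a ∧ 1 ≤ j ∧ j ≤ k - 1 ∧ ((j < r ∧ j % 2 = 0) ∨ (r ≤ j ∧ (j - r) % 2 = 1 ∧
     ¬ (k % 2 = 1 ∧ r % 2 = 1 ∧ j = k - 1))) ∧
     A1 = k - j ∧ B1 = - PP q j ∧ A2 = k - j + 1 ∧ B2 = PP q (j-1))

def ItU (a k r s A1 B1 A2 B2 : ℤ) : Prop :=
  (∃ _q c : ℤ, r ≤ c ∧ c ≤ k - 1 ∧ A1 = 0 ∧ B1 = c ∧ EP s (2 + c % 2) B2 ∧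
    ((A2 = k - c ∧ ¬ (k % 2 = 1 ∧ r % 2 = 1 ∧ c = k - 1)) ∨
      (k % 2 = 1 ∧ r % 2 = 1 ∧ c = k - 1 ∧ A2 = 2 ∧ s = 0))) ∨
  (∃ q _c : ℤ, 1 ≤ A1 ∧ A1 ≤ k - r ∧ q % 2 = 0 ∧ 2 ≤ q ∧ q ≤ a - 2 ∧ A2 = A1 ∧ VE s q B1 B2) ∨
  (∃ q _c : ℤ, k - r + 1 ≤ A1 ∧ A1 ≤ k ∧ q % 2 = 1 ∧ 1 ≤ q ∧ q ≤ a - 1 ∧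
    ¬ (q = a - 1 ∧ (A1 = k - r + 1 ∨ (r % 2 = 0 ∧ A1 = k - r + 2))) ∧ A2 = A1 ∧ VE s q B1 B2) ∨
  (∃ _q c : ℤ, 1 ≤ c ∧ r % 2 = 1 ∧ c % 2 = 1 ∧ c < r - 1 ∧ R0 c A1 B1 A2 B2) ∨
  (∃ _q _c : ℤ, A1 = 0 ∧ B1 = 0 ∧ s = 1 ∧ B2 = - PP a (r-1) ∧
    ((r % 2 = 1 ∧ A2 = k - r + 1) ∨ (r % 2 = 0 ∧ A2 = k - r + 2)))

def ItX (a k r s A1 B1 A2 B2 : ℤ) : Prop :=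
  (∃ _q c : ℤ, 0 ≤ c ∧ c < r ∧ A1 = 0 ∧ B1 = c ∧ EP s (2 + c % 2) B2 ∧
    ((A2 = k - c ∧ ¬ (r % 2 = 0 ∧ c = r - 1)) ∨ (r % 2 = 0 ∧ c = r - 1 ∧ A2 = k - r + 2 ∧ s = 1))) ∨
  (∃ _q c : ℤ, A1 = 0 ∧ s = 1 ∧ B2 = - PP a c ∧ B1 = c + k - r ∧
    ((r % 2 = 1 ∧ c = r - 1 ∧ A2 = k - r + 1) ∨ (r % 2 = 0 ∧ r - 2 ≤ c ∧ c ≤ r - 1 ∧ A2 = k - r + 2))) ∨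
  (∃ q _c : ℤ, 1 ≤ A1 ∧ A1 ≤ k - r ∧ q % 2 = 1 ∧ 1 ≤ q ∧ q ≤ a - 2 ∧ A2 = A1 ∧ VE s q B1 B2) ∨
  (∃ q _c : ℤ, k - r + 1 ≤ A1 ∧ A1 ≤ k ∧ q % 2 = 0 ∧ 2 ≤ q ∧ q ≤ a - 1 ∧
    ¬ (q = a - 1 ∧ (A1 = k - r + 1 ∨ (r % 2 = 0 ∧ A1 = k - r + 2))) ∧ A2 = A1 ∧ VE s q B1 B2) ∨
  (∃ _q c : ℤ, 1 ≤ c ∧ r % 2 = 1 ∧ c % 2 = 1 ∧ r - 1 ≤ c ∧ c ≤ k - 3 ∧ R0 c A1 B1 A2 B2) ∨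
  (∃ _q _c : ℤ, WN s (2*a-2) (2*a-1) B1 B2 ∧ A2 = A1 ∧
    ((r % 2 = 0 ∧ A1 = k - r + 2 ∧ s = 1) ∨ (k % 2 = 1 ∧ r % 2 = 1 ∧ A1 = 2 ∧ s = 0)))

def ItW (a k r s A1 B1 A2 B2 : ℤ) : Prop :=
  (∃ _q c : ℤ, r ≤ c ∧ c ≤ k - 1 ∧ A1 = 0 ∧ B1 = c - r ∧ EP s (PP (a-1) c) B2 ∧
    ((A2 = k - c ∧ ¬ (k % 2 = 1 ∧ r % 2 = 1 ∧ c = k - 1)) ∨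
      (k % 2 = 1 ∧ r % 2 = 1 ∧ c = k - 1 ∧ A2 = 2 ∧ s = 0))) ∨
  (∃ _q _c : ℤ, ((r % 2 = 1 ∧ A1 = k - r + 1) ∨ (r % 2 = 0 ∧ A1 = k - r + 2)) ∧ s = 1 ∧
     A2 = A1 ∧ VE s (a-1) B1 B2) ∨
  (∃ _q c : ℤ, (c = k - 2 ∨ (r % 2 = 0 ∧ c % 2 = 1 ∧ k - r ≤ c ∧ c ≤ k - 3)) ∧ R0 c A1 B1 A2 B2) ∨
  (∃ q _c : ℤ, 1 ≤ q ∧ q ≤ a - 2 ∧ WN s (2*q) (2*q+1) B1 B2 ∧ A2 = A1 ∧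
    ((r % 2 = 0 ∧ A1 = k - r + 2 ∧ s = 1) ∨ (k % 2 = 1 ∧ r % 2 = 1 ∧ A1 = 2 ∧ s = 0))) ∨
  (∃ q j : ℤ, 1 ≤ q ∧ q ≤ a ∧ 1 ≤ j ∧ j < r ∧ j % 2 = 1 ∧ ¬ (r % 2 = 0 ∧ j = r - 1) ∧
    A1 = k - j ∧ B1 = PP q j ∧ A2 = k - j + 1 ∧ B2 = - PP q (j-1))

def ItY (a k r s A1 B1 A2 B2 : ℤ) : Prop :=
  (∃ _q c : ℤ, 0 ≤ c ∧ c < r - 1 ∧ ¬ (r % 2 = 0 ∧ c = r - 2) ∧ A1 = 0 ∧ B1 = c + k - r ∧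
    A2 = k - c ∧ EP s (PP a c) B2) ∨
  (∃ _q c : ℤ, 1 ≤ c ∧ c % 2 = 1 ∧ r % 2 = 0 ∧ c < k - r ∧ R0 c A1 B1 A2 B2) ∨
  (∃ _q _c : ℤ, r % 2 = 0 ∧ A1 = k - r + 2 ∧ A2 = A1 ∧ s = 1 ∧ B1 = - (2*a+1) ∧ B2 = - (2*a)) ∨
  (∃ q j : ℤ, 1 ≤ q ∧ q ≤ a - 1 ∧ r ≤ j ∧ j ≤ k - 1 ∧ (j - r) % 2 = 0 ∧
    A1 = k - j ∧ B1 = PP q j ∧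
    ((j = r ∧ r % 2 = 0 ∧ A2 = k - j + 2) ∨ (¬ (j = r ∧ r % 2 = 0) ∧ A2 = k - j + 1)) ∧
    B2 = - PP q (j-1))

set_option maxHeartbeats 2000000 in
theorem noncrossH (a k r s A1 B1 A2 B2 s' C1 D1 C2 D2 : ℤ) (hp : Par a k r)
    (h1 : ItH a k r s A1 B1 A2 B2) (h2 : ItH a k r s' C1 D1 C2 D2) (hs : A2 = C2 → s = s')
    (l1 : LX A1 B1 C1 D1) (l2 : LX C1 D1 A2 B2) (l3 : LX A2 B2 C2 D2) :
    A1 = C1 ∧ B1 = D1 ∧ A2 = C2 ∧ B2 = D2 := by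
  obtain ⟨h3, h4, h5, h6⟩ := hp
  unfold ItH at h1 h2
  simp only [LX, R0, PP, EP, WN, VE] at *
  rcases h1 with ⟨q, c, h1⟩ | ⟨q, c, h1⟩ | ⟨q, c, h1⟩ | ⟨q, c, h1⟩
  · rcases h2 with ⟨q_, c_, h2⟩ | ⟨q_, c_, h2⟩ | ⟨q_, c_, h2⟩ | ⟨q_, c_, h2⟩
    · rcases l1 with l1 | l1 <;> rcases l2 with l2 | l2 <;> rcases l3 with l3 | l3 <;> omega
    · rcases l1 with l1 | l1 <;> rcases l2 with l2 | l2 <;> rcases l3 with l3 | l3 <;> omega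
    · rcases l1 with l1 | l1 <;> rcases l2 with l2 | l2 <;> rcases l3 with l3 | l3 <;> omega
    · rcases l1 with l1 | l1 <;> rcases l2 with l2 | l2 <;> rcases l3 with l3 | l3 <;> omega
  · rcases h2 with ⟨q_, c_, h2⟩ | ⟨q_, c_, h2⟩ | ⟨q_, c_, h2⟩ | ⟨q_, c_, h2⟩
    · rcases l1 with l1 | l1 <;> rcases l2 with l2 | l2 <;> rcases l3 with l3 | l3 <;> omega
    · rcases l1 with l1 | l1 <;> rcases l2 with l2 | l2 <;> rcases l3 with l3 | l3 <;> omega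
    · rcases l1 with l1 | l1 <;> rcases l2 with l2 | l2 <;> rcases l3 with l3 | l3 <;> omega
    · rcases l1 with l1 | l1 <;> rcases l2 with l2 | l2 <;> rcases l3 with l3 | l3 <;> omega
  · rcases h2 with ⟨q_, c_, h2⟩ | ⟨q_, c_, h2⟩ | ⟨q_, c_, h2⟩ | ⟨q_, c_, h2⟩
    · rcases l1 with l1 | l1 <;> rcases l2 with l2 | l2 <;> rcases l3 with l3 | l3 <;> omega
    · rcases l1 with l1 | l1 <;> rcases l2 with l2 | l2 <;> rcases l3 with l3 | l3 <;> omega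
    · rcases h6 with h6 | h6 | h6 <;> rcases lt_trichotomy q q_ with hq | rfl | hq <;> rcases l1 with l1 | l1 <;> rcases l2 with l2 | l2 <;> rcases l3 with l3 | l3 <;> omega
    · rcases h6 with h6 | h6 | h6 <;> rcases lt_trichotomy q q_ with hq | rfl | hq <;> rcases l1 with l1 | l1 <;> rcases l2 with l2 | l2 <;> rcases l3 with l3 | l3 <;> omega
  · rcases h2 with ⟨q_, c_, h2⟩ | ⟨q_, c_, h2⟩ | ⟨q_, c_, h2⟩ | ⟨q_, c_, h2⟩
    · rcases l1 with l1 | l1 <;> rcases l2 with l2 | l2 <;> rcases l3 with l3 | l3 <;> omega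
    · rcases l1 with l1 | l1 <;> rcases l2 with l2 | l2 <;> rcases l3 with l3 | l3 <;> omega
    · rcases h6 with h6 | h6 | h6 <;> rcases lt_trichotomy q q_ with hq | rfl | hq <;> rcases l1 with l1 | l1 <;> rcases l2 with l2 | l2 <;> rcases l3 with l3 | l3 <;> omega
    · clear h6 hs; obtain ⟨h11, h12, h13, h14, h15, rfl, rfl, rfl, rfl⟩ := h1; obtain ⟨h21, h22, h23, h24, h25, rfl, rfl, rfl, rfl⟩ := h2; rcases lt_trichotomy q q_ with hq | rfl | hq <;> rcases l1 with l1 | l1 <;> rcases l2 with l2 | l2 <;> rcases l3 with l3 | l3 <;> omega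

set_option maxHeartbeats 2000000 in
theorem noncrossU (a k r s A1 B1 A2 B2 s' C1 D1 C2 D2 : ℤ) (hp : Par a k r)
    (h1 : ItU a k r s A1 B1 A2 B2) (h2 : ItU a k r s' C1 D1 C2 D2) (hs : A2 = C2 → s = s')
    (l1 : LX A1 B1 C1 D1) (l2 : LX C1 D1 A2 B2) (l3 : LX A2 B2 C2 D2) :
    A1 = C1 ∧ B1 = D1 ∧ A2 = C2 ∧ B2 = D2 := by
  obtain ⟨h3, h4, h5, h6⟩ := hp
  unfold ItU at h1 h2
  simp only [LX, R0, PP, EP, WN, VE] at *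
  rcases h1 with ⟨q, c, h1⟩ | ⟨q, c, h1⟩ | ⟨q, c, h1⟩ | ⟨q, c, h1⟩ | ⟨q, c, h1⟩
  · rcases h2 with ⟨q_, c_, h2⟩ | ⟨q_, c_, h2⟩ | ⟨q_, c_, h2⟩ | ⟨q_, c_, h2⟩ | ⟨q_, c_, h2⟩
    · rcases l1 with l1 | l1 <;> rcases l2 with l2 | l2 <;> rcases l3 with l3 | l3 <;> omega
    · rcases l1 with l1 | l1 <;> rcases l2 with l2 | l2 <;> rcases l3 with l3 | l3 <;> omega
    · rcases l1 with l1 | l1 <;> rcases l2 with l2 | l2 <;> rcases l3 with l3 | l3 <;> omega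
    · rcases l1 with l1 | l1 <;> rcases l2 with l2 | l2 <;> rcases l3 with l3 | l3 <;> omega
    · rcases l1 with l1 | l1 <;> rcases l2 with l2 | l2 <;> rcases l3 with l3 | l3 <;> omega
  · rcases h2 with ⟨q_, c_, h2⟩ | ⟨q_, c_, h2⟩ | ⟨q_, c_, h2⟩ | ⟨q_, c_, h2⟩ | ⟨q_, c_, h2⟩
    · rcases l1 with l1 | l1 <;> rcases l2 with l2 | l2 <;> rcases l3 with l3 | l3 <;> omega
    · rcases lt_trichotomy q q_ with hq | rfl | hq <;> rcases l1 with l1 | l1 <;> rcases l2 with l2 | l2 <;> rcases l3 with l3 | l3 <;> omega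
    · rcases lt_trichotomy q q_ with hq | rfl | hq <;> rcases l1 with l1 | l1 <;> rcases l2 with l2 | l2 <;> rcases l3 with l3 | l3 <;> omega
    · rcases l1 with l1 | l1 <;> rcases l2 with l2 | l2 <;> rcases l3 with l3 | l3 <;> omega
    · rcases l1 with l1 | l1 <;> rcases l2 with l2 | l2 <;> rcases l3 with l3 | l3 <;> omega
  · rcases h2 with ⟨q_, c_, h2⟩ | ⟨q_, c_, h2⟩ | ⟨q_, c_, h2⟩ | ⟨q_, c_, h2⟩ | ⟨q_, c_, h2⟩
    · rcases l1 with l1 | l1 <;> rcases l2 with l2 | l2 <;> rcases l3 with l3 | l3 <;> omega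
    · rcases lt_trichotomy q q_ with hq | rfl | hq <;> rcases l1 with l1 | l1 <;> rcases l2 with l2 | l2 <;> rcases l3 with l3 | l3 <;> omega
    · rcases lt_trichotomy q q_ with hq | rfl | hq <;> rcases l1 with l1 | l1 <;> rcases l2 with l2 | l2 <;> rcases l3 with l3 | l3 <;> omega
    · rcases l1 with l1 | l1 <;> rcases l2 with l2 | l2 <;> rcases l3 with l3 | l3 <;> omega
    · rcases l1 with l1 | l1 <;> rcases l2 with l2 | l2 <;> rcases l3 with l3 | l3 <;> omega
  · rcases h2 with ⟨q_, c_, h2⟩ | ⟨q_, c_, h2⟩ | ⟨q_, c_, h2⟩ | ⟨q_, c_, h2⟩ | ⟨q_, c_, h2⟩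
    · rcases l1 with l1 | l1 <;> rcases l2 with l2 | l2 <;> rcases l3 with l3 | l3 <;> omega
    · rcases l1 with l1 | l1 <;> rcases l2 with l2 | l2 <;> rcases l3 with l3 | l3 <;> omega
    · rcases l1 with l1 | l1 <;> rcases l2 with l2 | l2 <;> rcases l3 with l3 | l3 <;> omega
    · rcases l1 with l1 | l1 <;> rcases l2 with l2 | l2 <;> rcases l3 with l3 | l3 <;> omega
    · rcases l1 with l1 | l1 <;> rcases l2 with l2 | l2 <;> rcases l3 with l3 | l3 <;> omega
  · rcases h2 with ⟨q_, c_, h2⟩ | ⟨q_, c_, h2⟩ | ⟨q_, c_, h2⟩ | ⟨q_, c_, h2⟩ | ⟨q_, c_, h2⟩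
    · rcases l1 with l1 | l1 <;> rcases l2 with l2 | l2 <;> rcases l3 with l3 | l3 <;> omega
    · rcases l1 with l1 | l1 <;> rcases l2 with l2 | l2 <;> rcases l3 with l3 | l3 <;> omega
    · rcases l1 with l1 | l1 <;> rcases l2 with l2 | l2 <;> rcases l3 with l3 | l3 <;> omega
    · rcases l1 with l1 | l1 <;> rcases l2 with l2 | l2 <;> rcases l3 with l3 | l3 <;> omega
    · rcases l1 with l1 | l1 <;> rcases l2 with l2 | l2 <;> rcases l3 with l3 | l3 <;> omega

set_option maxHeartbeats 2000000 in
theorem noncrossX (a k r s A1 B1 A2 B2 s' C1 D1 C2 D2 : ℤ) (hp : Par a k r)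
    (h1 : ItX a k r s A1 B1 A2 B2) (h2 : ItX a k r s' C1 D1 C2 D2) (hs : A2 = C2 → s = s')
    (l1 : LX A1 B1 C1 D1) (l2 : LX C1 D1 A2 B2) (l3 : LX A2 B2 C2 D2) :
    A1 = C1 ∧ B1 = D1 ∧ A2 = C2 ∧ B2 = D2 := by
  obtain ⟨h3, h4, h5, h6⟩ := hp
  unfold ItX at h1 h2
  simp only [LX, R0, PP, EP, WN, VE] at *
  rcases h1 with ⟨q, c, h1⟩ | ⟨q, c, h1⟩ | ⟨q, c, h1⟩ | ⟨q, c, h1⟩ | ⟨q, c, h1⟩ | ⟨q, c, h1⟩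
  · rcases h2 with ⟨q_, c_, h2⟩ | ⟨q_, c_, h2⟩ | ⟨q_, c_, h2⟩ | ⟨q_, c_, h2⟩ | ⟨q_, c_, h2⟩ | ⟨q_, c_, h2⟩
    · rcases l1 with l1 | l1 <;> rcases l2 with l2 | l2 <;> rcases l3 with l3 | l3 <;> omega
    · rcases l1 with l1 | l1 <;> rcases l2 with l2 | l2 <;> rcases l3 with l3 | l3 <;> omega
    · rcases l1 with l1 | l1 <;> rcases l2 with l2 | l2 <;> rcases l3 with l3 | l3 <;> omega
    · rcases l1 with l1 | l1 <;> rcases l2 with l2 | l2 <;> rcases l3 with l3 | l3 <;> omega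
    · rcases l1 with l1 | l1 <;> rcases l2 with l2 | l2 <;> rcases l3 with l3 | l3 <;> omega
    · rcases l1 with l1 | l1 <;> rcases l2 with l2 | l2 <;> rcases l3 with l3 | l3 <;> omega
  · rcases h2 with ⟨q_, c_, h2⟩ | ⟨q_, c_, h2⟩ | ⟨q_, c_, h2⟩ | ⟨q_, c_, h2⟩ | ⟨q_, c_, h2⟩ | ⟨q_, c_, h2⟩
    · rcases l1 with l1 | l1 <;> rcases l2 with l2 | l2 <;> rcases l3 with l3 | l3 <;> omega
    · rcases l1 with l1 | l1 <;> rcases l2 with l2 | l2 <;> rcases l3 with l3 | l3 <;> omega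
    · rcases l1 with l1 | l1 <;> rcases l2 with l2 | l2 <;> rcases l3 with l3 | l3 <;> omega
    · rcases l1 with l1 | l1 <;> rcases l2 with l2 | l2 <;> rcases l3 with l3 | l3 <;> omega
    · rcases l1 with l1 | l1 <;> rcases l2 with l2 | l2 <;> rcases l3 with l3 | l3 <;> omega
    · rcases l1 with l1 | l1 <;> rcases l2 with l2 | l2 <;> rcases l3 with l3 | l3 <;> omega
  · rcases h2 with ⟨q_, c_, h2⟩ | ⟨q_, c_, h2⟩ | ⟨q_, c_, h2⟩ | ⟨q_, c_, h2⟩ | ⟨q_, c_, h2⟩ | ⟨q_, c_, h2⟩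
    · rcases l1 with l1 | l1 <;> rcases l2 with l2 | l2 <;> rcases l3 with l3 | l3 <;> omega
    · rcases l1 with l1 | l1 <;> rcases l2 with l2 | l2 <;> rcases l3 with l3 | l3 <;> omega
    · rcases lt_trichotomy q q_ with hq | rfl | hq <;> rcases l1 with l1 | l1 <;> rcases l2 with l2 | l2 <;> rcases l3 with l3 | l3 <;> omega
    · rcases lt_trichotomy q q_ with hq | rfl | hq <;> rcases l1 with l1 | l1 <;> rcases l2 with l2 | l2 <;> rcases l3 with l3 | l3 <;> omega
    · rcases l1 with l1 | l1 <;> rcases l2 with l2 | l2 <;> rcases l3 with l3 | l3 <;> omega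
    · rcases l1 with l1 | l1 <;> rcases l2 with l2 | l2 <;> rcases l3 with l3 | l3 <;> omega
  · rcases h2 with ⟨q_, c_, h2⟩ | ⟨q_, c_, h2⟩ | ⟨q_, c_, h2⟩ | ⟨q_, c_, h2⟩ | ⟨q_, c_, h2⟩ | ⟨q_, c_, h2⟩
    · rcases l1 with l1 | l1 <;> rcases l2 with l2 | l2 <;> rcases l3 with l3 | l3 <;> omega
    · rcases l1 with l1 | l1 <;> rcases l2 with l2 | l2 <;> rcases l3 with l3 | l3 <;> omega
    · rcases lt_trichotomy q q_ with hq | rfl | hq <;> rcases l1 with l1 | l1 <;> rcases l2 with l2 | l2 <;> rcases l3 with l3 | l3 <;> omega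
    · rcases lt_trichotomy q q_ with hq | rfl | hq <;> rcases l1 with l1 | l1 <;> rcases l2 with l2 | l2 <;> rcases l3 with l3 | l3 <;> omega
    · rcases l1 with l1 | l1 <;> rcases l2 with l2 | l2 <;> rcases l3 with l3 | l3 <;> omega
    · rcases l1 with l1 | l1 <;> rcases l2 with l2 | l2 <;> rcases l3 with l3 | l3 <;> omega
  · rcases h2 with ⟨q_, c_, h2⟩ | ⟨q_, c_, h2⟩ | ⟨q_, c_, h2⟩ | ⟨q_, c_, h2⟩ | ⟨q_, c_, h2⟩ | ⟨q_, c_, h2⟩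
    · rcases l1 with l1 | l1 <;> rcases l2 with l2 | l2 <;> rcases l3 with l3 | l3 <;> omega
    · rcases l1 with l1 | l1 <;> rcases l2 with l2 | l2 <;> rcases l3 with l3 | l3 <;> omega
    · rcases l1 with l1 | l1 <;> rcases l2 with l2 | l2 <;> rcases l3 with l3 | l3 <;> omega
    · rcases l1 with l1 | l1 <;> rcases l2 with l2 | l2 <;> rcases l3 with l3 | l3 <;> omega
    · rcases l1 with l1 | l1 <;> rcases l2 with l2 | l2 <;> rcases l3 with l3 | l3 <;> omega
    · rcases l1 with l1 | l1 <;> rcases l2 with l2 | l2 <;> rcases l3 with l3 | l3 <;> omega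
  · rcases h2 with ⟨q_, c_, h2⟩ | ⟨q_, c_, h2⟩ | ⟨q_, c_, h2⟩ | ⟨q_, c_, h2⟩ | ⟨q_, c_, h2⟩ | ⟨q_, c_, h2⟩
    · rcases l1 with l1 | l1 <;> rcases l2 with l2 | l2 <;> rcases l3 with l3 | l3 <;> omega
    · rcases l1 with l1 | l1 <;> rcases l2 with l2 | l2 <;> rcases l3 with l3 | l3 <;> omega
    · rcases l1 with l1 | l1 <;> rcases l2 with l2 | l2 <;> rcases l3 with l3 | l3 <;> omega
    · rcases l1 with l1 | l1 <;> rcases l2 with l2 | l2 <;> rcases l3 with l3 | l3 <;> omega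
    · rcases l1 with l1 | l1 <;> rcases l2 with l2 | l2 <;> rcases l3 with l3 | l3 <;> omega
    · rcases l1 with l1 | l1 <;> rcases l2 with l2 | l2 <;> rcases l3 with l3 | l3 <;> omega

set_option maxHeartbeats 2000000 in
theorem noncrossW (a k r s A1 B1 A2 B2 s' C1 D1 C2 D2 : ℤ) (hp : Par a k r)
    (h1 : ItW a k r s A1 B1 A2 B2) (h2 : ItW a k r s' C1 D1 C2 D2) (hs : A2 = C2 → s = s')
    (l1 : LX A1 B1 C1 D1) (l2 : LX C1 D1 A2 B2) (l3 : LX A2 B2 C2 D2) :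
    A1 = C1 ∧ B1 = D1 ∧ A2 = C2 ∧ B2 = D2 := by
  obtain ⟨h3, h4, h5, h6⟩ := hp
  unfold ItW at h1 h2
  simp only [LX, R0, PP, EP, WN, VE] at *
  rcases h1 with ⟨q, c, h1⟩ | ⟨q, c, h1⟩ | ⟨q, c, h1⟩ | ⟨q, c, h1⟩ | ⟨q, c, h1⟩
  · rcases h2 with ⟨q_, c_, h2⟩ | ⟨q_, c_, h2⟩ | ⟨q_, c_, h2⟩ | ⟨q_, c_, h2⟩ | ⟨q_, c_, h2⟩
    · rcases l1 with l1 | l1 <;> rcases l2 with l2 | l2 <;> rcases l3 with l3 | l3 <;> omega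
    · rcases l1 with l1 | l1 <;> rcases l2 with l2 | l2 <;> rcases l3 with l3 | l3 <;> omega
    · rcases l1 with l1 | l1 <;> rcases l2 with l2 | l2 <;> rcases l3 with l3 | l3 <;> omega
    · rcases l1 with l1 | l1 <;> rcases l2 with l2 | l2 <;> rcases l3 with l3 | l3 <;> omega
    · rcases l1 with l1 | l1 <;> rcases l2 with l2 | l2 <;> rcases l3 with l3 | l3 <;> omega
  · rcases h2 with ⟨q_, c_, h2⟩ | ⟨q_, c_, h2⟩ | ⟨q_, c_, h2⟩ | ⟨q_, c_, h2⟩ | ⟨q_, c_, h2⟩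
    · rcases l1 with l1 | l1 <;> rcases l2 with l2 | l2 <;> rcases l3 with l3 | l3 <;> omega
    · rcases l1 with l1 | l1 <;> rcases l2 with l2 | l2 <;> rcases l3 with l3 | l3 <;> omega
    · rcases l1 with l1 | l1 <;> rcases l2 with l2 | l2 <;> rcases l3 with l3 | l3 <;> omega
    · rcases l1 with l1 | l1 <;> rcases l2 with l2 | l2 <;> rcases l3 with l3 | l3 <;> omega
    · rcases l1 with l1 | l1 <;> rcases l2 with l2 | l2 <;> rcases l3 with l3 | l3 <;> omega
  · rcases h2 with ⟨q_, c_, h2⟩ | ⟨q_, c_, h2⟩ | ⟨q_, c_, h2⟩ | ⟨q_, c_, h2⟩ | ⟨q_, c_, h2⟩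
    · rcases l1 with l1 | l1 <;> rcases l2 with l2 | l2 <;> rcases l3 with l3 | l3 <;> omega
    · rcases l1 with l1 | l1 <;> rcases l2 with l2 | l2 <;> rcases l3 with l3 | l3 <;> omega
    · rcases l1 with l1 | l1 <;> rcases l2 with l2 | l2 <;> rcases l3 with l3 | l3 <;> omega
    · rcases l1 with l1 | l1 <;> rcases l2 with l2 | l2 <;> rcases l3 with l3 | l3 <;> omega
    · rcases l1 with l1 | l1 <;> rcases l2 with l2 | l2 <;> rcases l3 with l3 | l3 <;> omega
  · rcases h2 with ⟨q_, c_, h2⟩ | ⟨q_, c_, h2⟩ | ⟨q_, c_, h2⟩ | ⟨q_, c_, h2⟩ | ⟨q_, c_, h2⟩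
    · rcases l1 with l1 | l1 <;> rcases l2 with l2 | l2 <;> rcases l3 with l3 | l3 <;> omega
    · rcases l1 with l1 | l1 <;> rcases l2 with l2 | l2 <;> rcases l3 with l3 | l3 <;> omega
    · rcases l1 with l1 | l1 <;> rcases l2 with l2 | l2 <;> rcases l3 with l3 | l3 <;> omega
    · rcases lt_trichotomy q q_ with hq | rfl | hq <;> rcases l1 with l1 | l1 <;> rcases l2 with l2 | l2 <;> rcases l3 with l3 | l3 <;> omega
    · rcases lt_trichotomy q q_ with hq | rfl | hq <;> rcases l1 with l1 | l1 <;> rcases l2 with l2 | l2 <;> rcases l3 with l3 | l3 <;> omega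
  · rcases h2 with ⟨q_, c_, h2⟩ | ⟨q_, c_, h2⟩ | ⟨q_, c_, h2⟩ | ⟨q_, c_, h2⟩ | ⟨q_, c_, h2⟩
    · rcases l1 with l1 | l1 <;> rcases l2 with l2 | l2 <;> rcases l3 with l3 | l3 <;> omega
    · rcases l1 with l1 | l1 <;> rcases l2 with l2 | l2 <;> rcases l3 with l3 | l3 <;> omega
    · rcases l1 with l1 | l1 <;> rcases l2 with l2 | l2 <;> rcases l3 with l3 | l3 <;> omega
    · rcases lt_trichotomy q q_ with hq | rfl | hq <;> rcases l1 with l1 | l1 <;> rcases l2 with l2 | l2 <;> rcases l3 with l3 | l3 <;> omega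
    · rcases lt_trichotomy q q_ with hq | rfl | hq <;> rcases l1 with l1 | l1 <;> rcases l2 with l2 | l2 <;> rcases l3 with l3 | l3 <;> omega

set_option maxHeartbeats 2000000 in
theorem noncrossY (a k r s A1 B1 A2 B2 s' C1 D1 C2 D2 : ℤ) (hp : Par a k r)
    (h1 : ItY a k r s A1 B1 A2 B2) (h2 : ItY a k r s' C1 D1 C2 D2) (hs : A2 = C2 → s = s')
    (l1 : LX A1 B1 C1 D1) (l2 : LX C1 D1 A2 B2) (l3 : LX A2 B2 C2 D2) :
    A1 = C1 ∧ B1 = D1 ∧ A2 = C2 ∧ B2 = D2 := by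
  obtain ⟨h3, h4, h5, h6⟩ := hp
  unfold ItY at h1 h2
  simp only [LX, R0, PP, EP, WN, VE] at *
  rcases h1 with ⟨q, c, h1⟩ | ⟨q, c, h1⟩ | ⟨q, c, h1⟩ | ⟨q, c, h1⟩
  · rcases h2 with ⟨q_, c_, h2⟩ | ⟨q_, c_, h2⟩ | ⟨q_, c_, h2⟩ | ⟨q_, c_, h2⟩
    · rcases l1 with l1 | l1 <;> rcases l2 with l2 | l2 <;> rcases l3 with l3 | l3 <;> omega
    · rcases l1 with l1 | l1 <;> rcases l2 with l2 | l2 <;> rcases l3 with l3 | l3 <;> omega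
    · rcases l1 with l1 | l1 <;> rcases l2 with l2 | l2 <;> rcases l3 with l3 | l3 <;> omega
    · rcases l1 with l1 | l1 <;> rcases l2 with l2 | l2 <;> rcases l3 with l3 | l3 <;> omega
  · rcases h2 with ⟨q_, c_, h2⟩ | ⟨q_, c_, h2⟩ | ⟨q_, c_, h2⟩ | ⟨q_, c_, h2⟩
    · rcases l1 with l1 | l1 <;> rcases l2 with l2 | l2 <;> rcases l3 with l3 | l3 <;> omega
    · rcases l1 with l1 | l1 <;> rcases l2 with l2 | l2 <;> rcases l3 with l3 | l3 <;> omega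
    · rcases l1 with l1 | l1 <;> rcases l2 with l2 | l2 <;> rcases l3 with l3 | l3 <;> omega
    · rcases l1 with l1 | l1 <;> rcases l2 with l2 | l2 <;> rcases l3 with l3 | l3 <;> omega
  · rcases h2 with ⟨q_, c_, h2⟩ | ⟨q_, c_, h2⟩ | ⟨q_, c_, h2⟩ | ⟨q_, c_, h2⟩
    · rcases l1 with l1 | l1 <;> rcases l2 with l2 | l2 <;> rcases l3 with l3 | l3 <;> omega
    · rcases l1 with l1 | l1 <;> rcases l2 with l2 | l2 <;> rcases l3 with l3 | l3 <;> omega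
    · rcases l1 with l1 | l1 <;> rcases l2 with l2 | l2 <;> rcases l3 with l3 | l3 <;> omega
    · rcases l1 with l1 | l1 <;> rcases l2 with l2 | l2 <;> rcases l3 with l3 | l3 <;> omega
  · rcases h2 with ⟨q_, c_, h2⟩ | ⟨q_, c_, h2⟩ | ⟨q_, c_, h2⟩ | ⟨q_, c_, h2⟩
    · rcases l1 with l1 | l1 <;> rcases l2 with l2 | l2 <;> rcases l3 with l3 | l3 <;> omega
    · rcases l1 with l1 | l1 <;> rcases l2 with l2 | l2 <;> rcases l3 with l3 | l3 <;> omega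
    · rcases l1 with l1 | l1 <;> rcases l2 with l2 | l2 <;> rcases l3 with l3 | l3 <;> omega
    · rcases lt_trichotomy q q_ with hq | rfl | hq <;> rcases l1 with l1 | l1 <;> rcases l2 with l2 | l2 <;> rcases l3 with l3 | l3 <;> omega

/-- Column merging. -/
def ctf (k r c : ℤ) : ℤ :=
  if r % 2 = 0 ∧ c = r - 1 then r - 2 else
  if k % 2 = 1 ∧ r % 2 = 1 ∧ c = k - 1 then k - 2 else c

/-- Sign of a block. -/
def sg (k r A : ℤ) : ℤ :=
  if (k - A < r ∧ (k - A) % 2 = 0) ∨ (r ≤ k - A ∧ (k - A - r) % 2 = 1) then 1 else 0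

/-- First key. -/
def K1 (k r q c : ℤ) : ℤ := if q = 0 then 0 else k - ctf k r c

/-- Second key. -/
def K2 (k r q c : ℤ) : ℤ :=
  if q = 0 then c else if sg k r (K1 k r q c) = 1 then - PP q c else PP q c

/-- Items of each colour. -/
def It : Fin 5 → ℤ → ℤ → ℤ → ℤ → ℤ → ℤ → ℤ → ℤ → Prop
  | 0 => ItH
  | 1 => ItU
  | 2 => ItX
  | 3 => ItW
  | 4 => ItY

/-- Oriented item between two vertices. -/
def OR (a k r : ℤ) (col : Fin 5) (q c q' c' : ℤ) : Prop :=
  It col a k r (sg k r (K1 k r q' c')) (K1 k r q c) (K2 k r q c) (K1 k r q' c') (K2 k r q' c')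

def OI (a k r : ℤ) (col : Fin 5) (q c q' c' : ℤ) : Prop :=
  OR a k r col q c q' c' ∨ OR a k r col q' c' q c

/-- Colour of the edge from `(q,c)` to its successor. -/
def hcol (a k r q c : ℤ) : Fin 5 :=
  if q = a ∧ c = r - 1 then 1 else
  if c = k - 1 then 0 else
  if q = 0 then
    (if c = k - 2 then 3 else if c % 2 = 0 then 0 else
      if r % 2 = 0 then (if c < k - r then 4 else 3) else (if c < r - 1 then 1 else 2)) else
  if r % 2 = 0 ∧ c = r - 2 then (if q = a then 4 else if q = a - 1 then 2 else 3) else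
  if k % 2 = 1 ∧ r % 2 = 1 ∧ c = k - 2 then (if q = a - 1 then 2 else 3) else
  if c + 1 < r then (if c % 2 = 1 then 0 else 3) else
  if (c + 1 - r) % 2 = 1 then 0 else 4

/-- Colour of the edge from `(q,c)` to the vertex `k` further. -/
def vcol (a k r q c : ℤ) : Fin 5 :=
  if q = 0 then (if r ≤ c then 1 else 2) else
  if q = a - 1 ∧ r ≤ c then 3 else
  if q = a then (if c = r - 1 ∨ (r % 2 = 0 ∧ c = r - 2) then 2 else 4) else
  if r ≤ c then (if q % 2 = 1 then 2 else 1) else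
  if q = a - 1 ∧ (c = r - 1 ∨ (r % 2 = 0 ∧ c = r - 2)) then 3 else
  if q % 2 = 1 then 1 else 2

theorem key0 (k r c : ℤ) : K1 k r 0 c = 0 ∧ K2 k r 0 c = c := by simp [K1, K2]

theorem key1 (k r q c : ℤ) (hq : 1 ≤ q) :
    ((r % 2 = 0 ∧ c = r - 1 ∧ K1 k r q c = k - (r - 2)) ∨
     (k % 2 = 1 ∧ r % 2 = 1 ∧ c = k - 1 ∧ K1 k r q c = 2) ∨
     (¬ (r % 2 = 0 ∧ c = r - 1) ∧ ¬ (k % 2 = 1 ∧ r % 2 = 1 ∧ c = k - 1) ∧ K1 k r q c = k - c)) := by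
  unfold K1 ctf
  split_ifs <;> omega

theorem sg_spec (k r A : ℤ) :
    (sg k r A = 1 ∧ ((k - A < r ∧ (k - A) % 2 = 0) ∨ (r ≤ k - A ∧ (k - A - r) % 2 = 1))) ∨
    (sg k r A = 0 ∧ ((k - A < r ∧ (k - A) % 2 = 1) ∨ (r ≤ k - A ∧ (k - A - r) % 2 = 0))) := by
  unfold sg
  split_ifs <;> omega

theorem key2 (k r q c : ℤ) (hq : 1 ≤ q) :
    (sg k r (K1 k r q c) = 1 ∧ K2 k r q c = - PP q c) ∨
    (sg k r (K1 k r q c) = 0 ∧ K2 k r q c = PP q c) := by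
  have := sg_spec k r (K1 k r q c)
  unfold K2
  split_ifs <;> omega

theorem hor0 (a k r c : ℤ) (hp : Par a k r) (h0 : 0 ≤ c) (h1 : c ≤ k - 2) :
    OI a k r (hcol a k r 0 c) 0 c 0 (c+1) := by
  obtain ⟨h3, h4, h5, h6⟩ := hp
  left
  unfold OR
  simp only [key0]
  unfold hcol
  split_ifs <;> simp only [It, ItH, ItU, ItX, ItW, ItY, R0, true_and, and_true]
  all_goals first | omega | skip
  · right; right; left; exact ⟨0, c, by omega⟩
  · left; exact ⟨0, c, by omega⟩
  · right; left; exact ⟨0, c, by omega⟩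
  · right; right; left; exact ⟨0, c, by omega⟩
  · right; right; right; left; exact ⟨0, c, by omega⟩
  · right; right; right; right; left; exact ⟨0, c, by omega⟩


theorem kU (k r q c : ℤ) (hq : 1 ≤ q) (h1 : ¬ (r % 2 = 0 ∧ c = r - 1))
    (h2 : ¬ (k % 2 = 1 ∧ r % 2 = 1 ∧ c = k - 1))
    (h3 : (c < r ∧ c % 2 = 1) ∨ (r ≤ c ∧ (c - r) % 2 = 0)) :
    K1 k r q c = k - c ∧ sg k r (K1 k r q c) = 0 ∧ K2 k r q c = PP q c := by
  have e : K1 k r q c = k - c := by have := key1 k r q c hq; omega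
  have f := key2 k r q c hq
  have g := sg_spec k r (K1 k r q c)
  rw [e] at *
  have : sg k r (k - c) = 0 := by clear f; omega
  omega

theorem kD (k r q c : ℤ) (hq : 1 ≤ q) (h1 : ¬ (r % 2 = 0 ∧ c = r - 1))
    (h2 : ¬ (k % 2 = 1 ∧ r % 2 = 1 ∧ c = k - 1))
    (h3 : (c < r ∧ c % 2 = 0) ∨ (r ≤ c ∧ (c - r) % 2 = 1)) :
    K1 k r q c = k - c ∧ sg k r (K1 k r q c) = 1 ∧ K2 k r q c = - PP q c := by
  have e : K1 k r q c = k - c := by have := key1 k r q c hq; omega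
  have f := key2 k r q c hq
  have g := sg_spec k r (K1 k r q c)
  rw [e] at *
  have : sg k r (k - c) = 1 := by clear f; omega
  omega

theorem kML (k r q c : ℤ) (hq : 1 ≤ q) (h1 : r % 2 = 0) (h2 : c = r - 1 ∨ c = r - 2) (hk : r < k) :
    K1 k r q c = k - r + 2 ∧ sg k r (K1 k r q c) = 1 ∧ K2 k r q c = - PP q c := by
  have e : K1 k r q c = k - r + 2 := by have := key1 k r q c hq; omega
  have f := key2 k r q c hq
  have g := sg_spec k r (K1 k r q c)
  rw [e] at *
  have : sg k r (k - r + 2) = 1 := by clear f; omega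
  omega

theorem kMR (k r q c : ℤ) (hq : 1 ≤ q) (h1 : r % 2 = 1) (h0 : k % 2 = 1)
    (h2 : c = k - 1 ∨ c = k - 2) (hk : r + 2 ≤ k) :
    K1 k r q c = 2 ∧ sg k r (K1 k r q c) = 0 ∧ K2 k r q c = PP q c := by
  have e : K1 k r q c = 2 := by have := key1 k r q c hq; omega
  have f := key2 k r q c hq
  have g := sg_spec k r (K1 k r q c)
  rw [e] at *
  have : sg k r 2 = 0 := by clear f; omega
  omega

theorem hor1 (a k r q c : ℤ) (hp : Par a k r) (h0 : 0 ≤ c) (h1 : c ≤ k - 2) (hq : 1 ≤ q)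
    (hqa : q ≤ a) (hac : q = a → c + 1 < r) :
    OI a k r (hcol a k r q c) q c q (c+1) := by
  obtain ⟨h3, h4, h5, h6⟩ := hp
  unfold OI OR
  by_cases i1 : r % 2 = 0 ∧ c = r - 2
  · obtain ⟨e1, e2, e3⟩ := kML k r q c hq i1.1 (by omega) (by omega)
    obtain ⟨f1, f2, f3⟩ := kML k r q (c+1) hq i1.1 (by omega) (by omega)
    rw [e2, f2, e1, f1, e3, f3]
    have hc : hcol a k r q c = if q = a then 4 else if q = a - 1 then 2 else 3 := by
      unfold hcol
      rw [if_neg (by omega), if_neg (by omega), if_neg (by omega), if_pos i1]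
    rw [hc]
    simp only [PP]
    rcases Int.emod_two_eq_zero_or_one (c + q) with hh | hh
    · left
      split_ifs
      · exfalso; omega
      · iterate 5 right
        refine ⟨q, c, ?_⟩
        unfold WN; omega
      · iterate 3 right
        left
        refine ⟨q, c, ?_⟩
        unfold WN; omega
    · right
      split_ifs
      · iterate 2 right
        left
        refine ⟨q, c, ?_⟩
        omega
      · iterate 5 right
        refine ⟨q, c, ?_⟩
        unfold WN; omega
      · iterate 3 right
        left
        refine ⟨q, c, ?_⟩
        unfold WN; omega
  by_cases i2 : k % 2 = 1 ∧ r % 2 = 1 ∧ c = k - 2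
  · obtain ⟨e1, e2, e3⟩ := kMR k r q c hq i2.2.1 i2.1 (by omega) (by omega)
    obtain ⟨f1, f2, f3⟩ := kMR k r q (c+1) hq i2.2.1 i2.1 (by omega) (by omega)
    rw [e2, f2, e1, f1, e3, f3]
    have hc : hcol a k r q c = if q = a - 1 then 2 else 3 := by
      unfold hcol
      rw [if_neg (by omega), if_neg (by omega), if_neg (by omega), if_neg i1, if_pos i2]
    rw [hc]
    simp only [PP]
    rcases Int.emod_two_eq_zero_or_one (c + q) with hh | hh
    · right
      split_ifs
      · iterate 5 right
        refine ⟨q, c, ?_⟩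
        unfold WN; omega
      · iterate 3 right
        left
        refine ⟨q, c, ?_⟩
        unfold WN; omega
    · left
      split_ifs
      · iterate 5 right
        refine ⟨q, c, ?_⟩
        unfold WN; omega
      · iterate 3 right
        left
        refine ⟨q, c, ?_⟩
        unfold WN; omega
  have hc : hcol a k r q c = if c + 1 < r then (if c % 2 = 1 then 0 else 3) else
      if (c + 1 - r) % 2 = 1 then 0 else 4 := by
    unfold hcol
    rw [if_neg (by omega), if_neg (by omega), if_neg (by omega), if_neg i1, if_neg i2]
  rw [hc]
  right
  split_ifs with j1 j2 j2
  · obtain ⟨e1, e2, e3⟩ := kU k r q c hq (by omega) (by omega) (by omega)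
    obtain ⟨f1, f2, f3⟩ := kD k r q (c+1) hq (by omega) (by omega) (by omega)
    rw [e2, e1, f1, e3, f3]
    iterate 3 right
    refine ⟨q, c + 1, ?_⟩
    rw [add_sub_cancel_right]
    omega
  · obtain ⟨e1, e2, e3⟩ := kD k r q c hq (by omega) (by omega) (by omega)
    obtain ⟨f1, f2, f3⟩ := kU k r q (c+1) hq (by omega) (by omega) (by omega)
    rw [e2, e1, f1, e3, f3]
    iterate 4 right
    refine ⟨q, c + 1, ?_⟩
    rw [add_sub_cancel_right]
    omega
  · obtain ⟨f1, f2, f3⟩ := kD k r q (c+1) hq (by omega) (by omega) (by omega)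
    obtain ⟨e1, e2, e3⟩ := kU k r q c hq (by omega) (by omega) (by omega)
    rw [e2, e1, f1, e3, f3]
    iterate 3 right
    refine ⟨q, c + 1, ?_⟩
    rw [add_sub_cancel_right]
    omega
  · obtain ⟨f1, f2, f3⟩ := kU k r q (c+1) hq (by omega) (by omega) (by omega)
    by_cases hm : r % 2 = 0 ∧ c = r - 1
    · obtain ⟨e1, e2, e3⟩ := kML k r q c hq hm.1 (by omega) (by omega)
      rw [e2, e1, f1, e3, f3]
      iterate 3 right
      refine ⟨q, c + 1, ?_⟩
      rw [add_sub_cancel_right]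
      omega
    · obtain ⟨e1, e2, e3⟩ := kD k r q c hq (by omega) (by omega) (by omega)
      rw [e2, e1, f1, e3, f3]
      iterate 3 right
      refine ⟨q, c + 1, ?_⟩
      rw [add_sub_cancel_right]
      omega

theorem helix (a k r q : ℤ) (hp : Par a k r) (hq : 0 ≤ q) (hqa : q ≤ a - 1) :
    OI a k r (hcol a k r q (k-1)) q (k-1) (q+1) 0 := by
  obtain ⟨h3, h4, h5, h6⟩ := hp
  left
  unfold OR
  have hc : hcol a k r q (k-1) = 0 := by
    unfold hcol
    rw [if_neg (by omega), if_pos rfl]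
  obtain ⟨e1, e2, e3⟩ := kD k r (q+1) 0 (by omega) (by omega) (by omega) (by omega)
  rw [hc, e2, e1, e3]
  rcases eq_or_lt_of_le hq with rfl | hq'
  · simp only [key0]
    right; left
    refine ⟨0, 0, ?_⟩
    unfold PP
    omega
  · right; right; left
    refine ⟨q, 0, ?_⟩
    by_cases hm : k % 2 = 1 ∧ r % 2 = 1
    · obtain ⟨f1, f2, f3⟩ := kMR k r q (k-1) (by omega) hm.2 hm.1 (by omega) (by omega)
      rw [f1, f3]
      omega
    · obtain ⟨f1, f2, f3⟩ := kU k r q (k-1) (by omega) (by omega) (by omega) (by omega)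
      rw [f1, f3]
      omega

theorem final (a k r : ℤ) (hp : Par a k r) :
    OI a k r (hcol a k r a (r-1)) a (r-1) 0 0 := by
  obtain ⟨h3, h4, h5, h6⟩ := hp
  right
  unfold OR
  have hc : hcol a k r a (r-1) = 1 := by
    unfold hcol
    rw [if_pos ⟨rfl, rfl⟩]
  rw [hc, (key0 k r 0).1, (key0 k r 0).2]
  iterate 4 right
  refine ⟨0, 0, ?_⟩
  by_cases hm : r % 2 = 0
  · obtain ⟨f1, f2, f3⟩ := kML k r a (r-1) (by omega) hm (by omega) (by omega)
    rw [f2, f1, f3]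
    omega
  · obtain ⟨f1, f2, f3⟩ := kD k r a (r-1) (by omega) (by omega) (by omega) (by omega)
    rw [f2, f1, f3]
    omega

theorem ep_key (k r q c : ℤ) (hq : 1 ≤ q) : EP (sg k r (K1 k r q c)) (PP q c) (K2 k r q c) := by
  have := key2 k r q c hq
  unfold EP
  omega

theorem vert0 (a k r c : ℤ) (hp : Par a k r) (h0 : 0 ≤ c) (h1 : c ≤ k - 1) :
    OI a k r (vcol a k r 0 c) 0 c 1 c := by
  obtain ⟨h3, h4, h5, h6⟩ := hp
  left
  unfold OR
  have hc : vcol a k r 0 c = if r ≤ c then 1 else 2 := by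
    unfold vcol
    rw [if_pos rfl]
  have e := ep_key k r 1 c (by omega)
  have hP : PP 1 c = 2 + c % 2 := by unfold PP; omega
  rw [hP] at e
  rw [hc, (key0 k r c).1, (key0 k r c).2]
  have k1 := key1 k r 1 c (by omega)
  have k3 := kML k r 1 c (by omega)
  have k4 := kMR k r 1 c (by omega)
  split_ifs
  · left
    refine ⟨0, c, by omega, by omega, rfl, rfl, e, ?_⟩
    by_cases hm : k % 2 = 1 ∧ r % 2 = 1 ∧ c = k - 1
    · have := k4 hm.2.1 hm.1 (by omega) (by omega)
      omega
    · omega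
  · left
    refine ⟨0, c, by omega, by omega, rfl, rfl, e, ?_⟩
    by_cases hm : r % 2 = 0 ∧ c = r - 1
    · have := k3 hm.1 (by omega) (by omega)
      omega
    · omega

theorem vert_core (k r q c : ℤ) (hq : 1 ≤ q) :
    K1 k r (q+1) c = K1 k r q c ∧
    (VE (sg k r (K1 k r q c)) q (K2 k r q c) (K2 k r (q+1) c) ∨
     VE (sg k r (K1 k r q c)) q (K2 k r (q+1) c) (K2 k r q c)) := by
  have e : K1 k r (q+1) c = K1 k r q c := by
    unfold K1
    rw [if_neg (by omega), if_neg (by omega)]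
  refine ⟨e, ?_⟩
  have f1 := key2 k r q c hq
  have f2 := key2 k r (q+1) c (by omega)
  rw [e] at f2
  generalize sg k r (K1 k r q c) = s at *
  generalize K2 k r q c = B1 at *
  generalize K2 k r (q+1) c = B2 at *
  unfold VE WN
  unfold PP at f1 f2
  rcases f1 with ⟨f0, f1⟩ | ⟨f0, f1⟩
  · have f2' : B2 = -(2 * (q + 1) + (c + (q + 1) + 1) % 2) := by omega
    clear f2
    right
    rcases Int.emod_two_eq_zero_or_one (c + q) with hh | hh
    · right; right; omega
    · left; right; omega
  · have f2' : B2 = 2 * (q + 1) + (c + (q + 1) + 1) % 2 := by omega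
    clear f2
    left
    rcases Int.emod_two_eq_zero_or_one (c + q) with hh | hh
    · right; left; omega
    · left; left; omega

/-- Conditions on a vertical edge in a block, per colour. -/
theorem vert1 (a k r q c : ℤ) (hp : Par a k r) (h0 : 0 ≤ c) (h1 : c ≤ k - 1) (hq : 1 ≤ q)
    (hqa : q ≤ a - 1) (hac : q = a - 1 → c < r) :
    OI a k r (vcol a k r q c) q c (q+1) c := by
  obtain ⟨h3, h4, h5, h6⟩ := hp
  obtain ⟨e, f⟩ := vert_core k r q c hq
  have k1 := key1 k r q c hq
  have k3 := kML k r q c hq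
  have k5 := kD k r q c hq
  unfold OI OR
  rw [e]
  have hc : vcol a k r q c = if r ≤ c then (if q % 2 = 1 then 2 else 1) else
      if q = a - 1 ∧ (c = r - 1 ∨ (r % 2 = 0 ∧ c = r - 2)) then 3 else
      if q % 2 = 1 then 1 else 2 := by
    unfold vcol
    rw [if_neg (by omega), if_neg (by omega), if_neg (by omega)]
  rw [hc]
  generalize sg k r (K1 k r q c) = s at *
  generalize K2 k r q c = B1 at *
  generalize K2 k r (q+1) c = B2 at *
  generalize K1 k r q c = A at *
  have g1 : r ≤ c → 1 ≤ A ∧ A ≤ k - r := by clear k3 k5 f hc; omega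
  have g2 : c < r → k - r + 1 ≤ A ∧ A ≤ k := by clear k3 k5 f hc; omega
  have g3 : c < r → ¬ (q = a - 1 ∧ (c = r - 1 ∨ (r % 2 = 0 ∧ c = r - 2))) →
      ¬ (q = a - 1 ∧ (A = k - r + 1 ∨ (r % 2 = 0 ∧ A = k - r + 2))) := by
    clear k3 k5 f hc; omega
  clear k1 hc
  split_ifs with j1 j2 j2 j3
  · clear k3 k5
    have g := g1 j1
    have hq2 : q ≤ a - 2 := by omega
    refine f.imp (fun f => ?_) (fun f => ?_)
    all_goals
      right; right; left
      exact ⟨q, c, g.1, g.2, j2, hq, hq2, rfl, f⟩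
  · clear k3 k5
    have g := g1 j1
    have hq2 : q ≤ a - 2 := by omega
    have hq3 : q % 2 = 0 := by omega
    have hq4 : 2 ≤ q := by omega
    refine f.imp (fun f => ?_) (fun f => ?_)
    all_goals
      right; left
      exact ⟨q, c, g.1, g.2, hq3, hq4, hq2, rfl, f⟩
  · have hs : ((r % 2 = 1 ∧ A = k - r + 1) ∨ (r % 2 = 0 ∧ A = k - r + 2)) ∧ s = 1 := by
      by_cases hm : r % 2 = 0
      · have := k3 hm (by omega) (by omega)
        omega
      · have := k5 (by omega) (by omega) (by omega)
        omega
    obtain ⟨rfl, -⟩ := j2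
    refine f.imp (fun f => ?_) (fun f => ?_)
    all_goals
      right; left
      exact ⟨0, c, hs.1, hs.2, rfl, f⟩
  · clear k3 k5
    have g := g2 (by omega)
    have g' := g3 (by omega) j2
    refine f.imp (fun f => ?_) (fun f => ?_)
    all_goals
      right; right; left
      exact ⟨q, c, g.1, g.2, j3, hq, hqa, g', rfl, f⟩
  · clear k3 k5
    have g := g2 (by omega)
    have g' := g3 (by omega) j2
    have hq3 : q % 2 = 0 := by omega
    have hq4 : 2 ≤ q := by omega
    refine f.imp (fun f => ?_) (fun f => ?_)
    all_goals
      right; right; right; left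
      exact ⟨q, c, g.1, g.2, hq3, hq4, hqa, g', rfl, f⟩

theorem wrap1 (a k r c : ℤ) (hp : Par a k r) (h0 : r ≤ c) (h1 : c ≤ k - 1) :
    OI a k r (vcol a k r (a-1) c) (a-1) c 0 (c-r) := by
  obtain ⟨h3, h4, h5, h6⟩ := hp
  right
  unfold OR
  have hc : vcol a k r (a-1) c = 3 := by
    unfold vcol
    rw [if_neg (by omega), if_pos (by omega)]
  have e := ep_key k r (a-1) c (by omega)
  rw [hc, (key0 k r _).1, (key0 k r _).2]
  have k1 := key1 k r (a-1) c (by omega)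
  have k4 := kMR k r (a-1) c (by omega)
  left
  refine ⟨0, c, by omega, by omega, rfl, rfl, e, ?_⟩
  by_cases hm : k % 2 = 1 ∧ r % 2 = 1 ∧ c = k - 1
  · have := k4 hm.2.1 hm.1 (by omega) (by omega)
    omega
  · omega

theorem wrap2 (a k r c : ℤ) (hp : Par a k r) (h0 : 0 ≤ c) (h1 : c < r) :
    OI a k r (vcol a k r a c) a c 0 (c+k-r) := by
  obtain ⟨h3, h4, h5, h6⟩ := hp
  right
  unfold OR
  have hc : vcol a k r a c = if c = r - 1 ∨ (r % 2 = 0 ∧ c = r - 2) then 2 else 4 := by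
    unfold vcol
    rw [if_neg (by omega), if_neg (by omega), if_pos rfl]
  have e := ep_key k r a c (by omega)
  rw [hc, (key0 k r _).1, (key0 k r _).2]
  have k1 := key1 k r a c (by omega)
  split_ifs
  · right; left
    by_cases hm : r % 2 = 0
    · obtain ⟨f1, f2, f3⟩ := kML k r a c (by omega) hm (by omega) (by omega)
      rw [f2, f1, f3]
      exact ⟨0, c, by omega⟩
    · obtain ⟨f1, f2, f3⟩ := kD k r a c (by omega) (by omega) (by omega) (by omega)
      rw [f2, f1, f3]
      exact ⟨0, c, by omega⟩
  · left
    exact ⟨0, c, by omega, by omega, by omega, rfl, rfl, by omega, e⟩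

set_option maxHeartbeats 1000000 in
theorem le_item (a k r s A1 B1 A2 B2 : ℤ) (col : Fin 5) (hp : Par a k r)
    (h : It col a k r s A1 B1 A2 B2) : LX A1 B1 A2 B2 := by
  obtain ⟨h3, h4, h5, h6⟩ := hp
  fin_cases col
  · change ItH a k r s A1 B1 A2 B2 at h
    unfold ItH at h
    simp only [R0, PP] at h
    unfold LX
    rcases h with ⟨q, c, h⟩ | ⟨q, c, h⟩ | ⟨q, c, h⟩ | ⟨q, c, h⟩ <;> omega
  · change ItU a k r s A1 B1 A2 B2 at h
    unfold ItU at h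
    simp only [R0, PP, VE, WN, EP] at h
    unfold LX
    rcases h with ⟨q, c, h⟩ | ⟨q, c, h⟩ | ⟨q, c, h⟩ | ⟨q, c, h⟩ | ⟨q, c, h⟩ <;> omega
  · change ItX a k r s A1 B1 A2 B2 at h
    unfold ItX at h
    simp only [R0, PP, VE, WN, EP] at h
    unfold LX
    rcases h with ⟨q, c, h⟩ | ⟨q, c, h⟩ | ⟨q, c, h⟩ | ⟨q, c, h⟩ | ⟨q, c, h⟩ | ⟨q, c, h⟩ <;> omega
  · change ItW a k r s A1 B1 A2 B2 at h
    unfold ItW at h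
    simp only [R0, PP, VE, WN, EP] at h
    unfold LX
    rcases h with ⟨q, c, h⟩ | ⟨q, c, h⟩ | ⟨q, c, h⟩ | ⟨q, c, h⟩ | ⟨q, c, h⟩ <;> omega
  · change ItY a k r s A1 B1 A2 B2 at h
    unfold ItY at h
    simp only [R0, PP, EP] at h
    unfold LX
    rcases h with ⟨q, c, h⟩ | ⟨q, c, h⟩ | ⟨q, c, h⟩ | ⟨q, c, h⟩ <;> omega

theorem noncrossAll (a k r s A1 B1 A2 B2 s' C1 D1 C2 D2 : ℤ) (col : Fin 5) (hp : Par a k r)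
    (h1 : It col a k r s A1 B1 A2 B2) (h2 : It col a k r s' C1 D1 C2 D2) (hs : A2 = C2 → s = s')
    (l1 : LX A1 B1 C1 D1) (l2 : LX C1 D1 A2 B2) (l3 : LX A2 B2 C2 D2) :
    A1 = C1 ∧ B1 = D1 ∧ A2 = C2 ∧ B2 = D2 := by
  fin_cases col
  · exact noncrossH a k r s A1 B1 A2 B2 s' C1 D1 C2 D2 hp h1 h2 hs l1 l2 l3
  · exact noncrossU a k r s A1 B1 A2 B2 s' C1 D1 C2 D2 hp h1 h2 hs l1 l2 l3
  · exact noncrossX a k r s A1 B1 A2 B2 s' C1 D1 C2 D2 hp h1 h2 hs l1 l2 l3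
  · exact noncrossW a k r s A1 B1 A2 B2 s' C1 D1 C2 D2 hp h1 h2 hs l1 l2 l3
  · exact noncrossY a k r s A1 B1 A2 B2 s' C1 D1 C2 D2 hp h1 h2 hs l1 l2 l3

/-- Lexicographic key of a vertex. -/
def fkey (k r : ℤ) (p : ℤ × ℤ) : ℤ ×ₗ ℤ := toLex (K1 k r p.1 p.2, K2 k r p.1 p.2)

theorem LX_iff (A B C D : ℤ) : LX A B C D ↔ (toLex (A, B) : ℤ ×ₗ ℤ) ≤ toLex (C, D) := by
  rw [Prod.Lex.toLex_le_toLex]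
  rfl

theorem OR_le (a k r : ℤ) (hp : Par a k r) (col : Fin 5) (x y : ℤ × ℤ)
    (h : OR a k r col x.1 x.2 y.1 y.2) : fkey k r x ≤ fkey k r y := by
  exact (LX_iff _ _ _ _).1 (le_item _ _ _ _ _ _ _ _ _ hp h)

theorem OR_cross (a k r : ℤ) (hp : Par a k r) (col : Fin 5) (x y z w : ℤ × ℤ)
    (h : OR a k r col x.1 x.2 y.1 y.2) (h' : OR a k r col z.1 z.2 w.1 w.2)
    (l1 : fkey k r x ≤ fkey k r z) (l2 : fkey k r z ≤ fkey k r y)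
    (l3 : fkey k r y ≤ fkey k r w) : fkey k r x = fkey k r z ∧ fkey k r y = fkey k r w := by
  obtain ⟨e1, e2, e3, e4⟩ := noncrossAll _ _ _ _ _ _ _ _ _ _ _ _ _ _ hp h h' (fun e => by rw [e])
    ((LX_iff _ _ _ _).2 l1) ((LX_iff _ _ _ _).2 l2) ((LX_iff _ _ _ _).2 l3)
  unfold fkey
  rw [e1, e2, e3, e4]
  exact ⟨rfl, rfl⟩

theorem fkey_inj (a k r : ℤ) (hp : Par a k r) (x y : ℤ × ℤ)
    (hx : 0 ≤ x.1 ∧ 0 ≤ x.2 ∧ x.2 < k) (hy : 0 ≤ y.1 ∧ 0 ≤ y.2 ∧ y.2 < k)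
    (h : fkey k r x = fkey k r y) : x = y := by
  obtain ⟨q, c⟩ := x
  obtain ⟨q', c'⟩ := y
  obtain ⟨h3, h4, h5, h6⟩ := hp
  have h' := Prod.ext_iff.1 (toLex.injective h)
  obtain ⟨e1, e2⟩ := h'
  simp only at e1 e2 hx hy
  rcases eq_or_lt_of_le hx.1 with rfl | hq <;> rcases eq_or_lt_of_le hy.1 with rfl | hq'
  · simp only [key0] at e2
    rw [e2]
  · have := key1 k r q' c' hq'
    rw [(key0 k r c).1] at e1
    omega
  · have := key1 k r q c hq
    rw [(key0 k r c').1] at e1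
    omega
  · have k1 := key1 k r q c hq
    have k2 := key1 k r q' c' hq'
    have f1 := key2 k r q c hq
    have f2 := key2 k r q' c' hq'
    rw [e1] at f1 k1
    rw [e2] at f1
    have hP : PP q c = PP q' c' := by clear k1 k2; omega
    clear f1 f2
    unfold PP at hP
    have hqq : q = q' := by clear k1 k2; omega
    subst hqq
    have hcc : c = c' := by omega
    rw [hcc]

/-- Sorting a finite type along an injective key. -/
theorem exists_sort {V L : Type*} [Fintype V] [LinearOrder L] (f : V → L)
    (hf : Function.Injective f) : ∃ σ : V ≃ Fin (Nat.card V), ∀ x y, σ x < σ y ↔ f x < f y := by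
  letI : LinearOrder V := LinearOrder.lift' f hf
  have e : V ≃o Fin (Nat.card V) := (Fintype.orderIsoFinOfCardEq V (by simp)).symm
  exact ⟨e.toEquiv, fun x y => e.lt_iff_lt⟩

theorem OI_cross (a k r : ℤ) (hp : Par a k r) (col : Fin 5) (x y z w : ℤ × ℤ)
    (h : OI a k r col x.1 x.2 y.1 y.2) (h' : OI a k r col z.1 z.2 w.1 w.2)
    (l1 : fkey k r x < fkey k r z) (l2 : fkey k r z < fkey k r y)
    (l3 : fkey k r y < fkey k r w) : False := by
  have hxy := l1.trans l2
  have hzw := l2.trans l3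
  have g : OR a k r col x.1 x.2 y.1 y.2 := by
    rcases h with h | h
    · exact h
    · exact absurd (OR_le a k r hp col y x h) (not_le.2 hxy)
  have g' : OR a k r col z.1 z.2 w.1 w.2 := by
    rcases h' with h | h
    · exact h
    · exact absurd (OR_le a k r hp col w z h) (not_le.2 hzw)
  have := OR_cross a k r hp col x y z w g g' l1.le l2.le l3.le
  exact l1.ne this.1

theorem OR_share (a k r : ℤ) (hp : Par a k r) (col : Fin 5) (x y w : ℤ × ℤ)
    (h : OI a k r col x.1 x.2 y.1 y.2) (h' : OI a k r col x.1 x.2 w.1 w.2) 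
    (hy : fkey k r x ≠ fkey k r y) (hw : fkey k r x ≠ fkey k r w) :
    fkey k r y = fkey k r w := by
  rcases h with h | h <;> rcases h' with h' | h'
  · have g := OR_le a k r hp col _ _ h
    have g' := OR_le a k r hp col _ _ h'
    rcases le_total (fkey k r y) (fkey k r w) with l | l
    · exact (OR_cross a k r hp col _ _ _ _ h h' le_rfl g l).2
    · exact (OR_cross a k r hp col _ _ _ _ h' h le_rfl g' l).2.symm
  · have g := OR_le a k r hp col _ _ h
    have g' := OR_le a k r hp col _ _ h'
    exact absurd (OR_cross a k r hp col _ _ _ _ h' h g' le_rfl g).2 hy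
  · have g := OR_le a k r hp col _ _ h
    have g' := OR_le a k r hp col _ _ h'
    exact absurd (OR_cross a k r hp col _ _ _ _ h h' g le_rfl g').2 hw
  · have g := OR_le a k r hp col _ _ h
    have g' := OR_le a k r hp col _ _ h'
    rcases le_total (fkey k r y) (fkey k r w) with l | l
    · exact (OR_cross a k r hp col _ _ _ _ h h' l g' le_rfl).1
    · exact (OR_cross a k r hp col _ _ _ _ h' h l g le_rfl).1.symm

theorem OI_symm {a k r : ℤ} {col : Fin 5} {q c q' c' : ℤ} (h : OI a k r col q c q' c') :
    OI a k r col q' c' q c := Or.symm h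

theorem cross_core (a k r : ℤ) (hp : Par a k r) (col : Fin 5) (x y z w : ℤ × ℤ)
    (h : OI a k r col x.1 x.2 y.1 y.2) (h' : OI a k r col z.1 z.2 w.1 w.2)
    (hzw : fkey k r z ≠ fkey k r w) (inj : fkey k r w = fkey k r x → w = x)
    (inj' : fkey k r w = fkey k r y → w = y)
    (l1 : fkey k r x < fkey k r z) (l2 : fkey k r z < fkey k r y)
    (l3 : ¬ (fkey k r x < fkey k r w ∧ fkey k r w < fkey k r y)) : False := by
  rcases lt_trichotomy (fkey k r w) (fkey k r x) with g | g | g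
  · exact OI_cross a k r hp col w z x y (OI_symm h') h g l1 l2
  · have := inj g
    subst this
    have := OR_share a k r hp col w y z h (OI_symm h') (l1.trans l2).ne hzw.symm
    exact l2.ne this.symm
  · rcases lt_trichotomy (fkey k r w) (fkey k r y) with g' | g' | g'
    · exact l3 ⟨g, g'⟩
    · have := inj' g'
      subst this
      have := OR_share a k r hp col w x z (OI_symm h) (OI_symm h') (l1.trans l2).ne' hzw.symm
      exact l1.ne this
    · exact OI_cross a k r hp col x y z w h h' l1 l2 g'

theorem mbe_of {V : Type*} [Fintype V] (G : SimpleGraph V) (a k r : ℤ) (hp : Par a k r)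
    (p : V → ℤ × ℤ) (hinj : Function.Injective (fun v => fkey k r (p v)))
    (col : V → V → Fin 5) (hsymm : ∀ u v, G.Adj u v → col u v = col v u)
    (hOI : ∀ u v, G.Adj u v → OI a k r (col u v) (p u).1 (p u).2 (p v).1 (p v).2) :
    HasMBE G 5 := by
  obtain ⟨σ, hσ⟩ := exists_sort (fun v => fkey k r (p v)) hinj
  refine ⟨σ, col, hsymm, ?_, ?_⟩
  · intro u v w h1 h2 hvw hc
    have o1 := hOI u v h1
    have o2 := hOI u w h2
    rw [← hc] at o2
    exact hvw (hinj (OR_share a k r hp _ _ _ _ o1 o2 (fun e => h1.ne (hinj e))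
      (fun e => h2.ne (hinj e))))
  · have key : ∀ x y z w, G.Adj x y → G.Adj z w → col x y = col z w →
        σ x < σ z → σ z < σ y → ¬ (σ x < σ w ∧ σ w < σ y) → False := by
      intro x y z w h1 h2 hc l1 l2 l3
      have o1 := hOI x y h1
      have o2 := hOI z w h2
      rw [← hc] at o2
      rw [hσ] at l1 l2
      rw [hσ, hσ] at l3
      exact cross_core a k r hp _ _ _ _ _ o1 o2 (fun e => h2.ne (hinj e))
        (fun e => congrArg p (hinj e)) (fun e => congrArg p (hinj e)) l1 l2 l3
    have key2 : ∀ x y z w, G.Adj x y → G.Adj z w → col x y = col z w →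
        ChordBetween (σ z) (σ x) (σ y) → ¬ ChordBetween (σ w) (σ x) (σ y) → False := by
      intro x y z w h1 h2 hc b1 b2
      unfold ChordBetween at b1 b2
      rcases le_total (σ x) (σ y) with l | l
      · rw [min_eq_left l, max_eq_right l] at b1 b2
        exact key x y z w h1 h2 hc b1.1 b1.2 b2
      · rw [min_eq_right l, max_eq_left l] at b1 b2
        exact key y x z w h1.symm h2 ((hsymm _ _ h1).symm.trans hc) b1.1 b1.2 b2
    intro x y z w h1 h2 hX hc
    rcases hX with ⟨b1, b2⟩ | ⟨b1, b2⟩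
    · exact key2 x y z w h1 h2 hc b1 b2
    · exact key2 x y w z h1 h2.symm (hc.trans (hsymm _ _ h2)) b1 b2

theorem circ_adj (n k : ℕ) (u v : ZMod n) : (circ n k).Adj u v ↔
    u ≠ v ∧ (v = u + 1 ∨ u = v + 1 ∨ v = u + k ∨ u = v + k) := by
  unfold circ circulant
  rw [SimpleGraph.fromRel_adj]
  refine and_congr Iff.rfl ?_
  simp only [Set.mem_insert_iff, Set.mem_singleton_iff, exists_eq_or_imp, exists_eq_left,
    Int.cast_one, Int.cast_natCast, sub_eq_iff_eq_add, add_comm (1 : ZMod n), add_comm (k : ZMod n)]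
  tauto

/-- Coordinates of a vertex. -/
def crd (n k : ℕ) (u : ZMod n) : ℤ × ℤ := (((u.val / k : ℕ) : ℤ), ((u.val % k : ℕ) : ℤ))

theorem val_succ (n : ℕ) (hn : 1 < n) (u : ZMod n) :
    (u + 1).val = if u.val + 1 = n then 0 else u.val + 1 := by
  haveI : NeZero n := ⟨by omega⟩
  haveI : Fact (1 < n) := ⟨hn⟩
  rw [ZMod.val_add, ZMod.val_one]
  have := u.val_lt
  split_ifs with h
  · rw [h, Nat.mod_self]
  · exact Nat.mod_eq_of_lt (by omega)

theorem val_addk (n k : ℕ) (hn : k < n) (u : ZMod n) :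
    (u + k).val = if u.val + k < n then u.val + k else u.val + k - n := by
  haveI : NeZero n := ⟨by omega⟩
  rw [ZMod.val_add, ZMod.val_natCast, Nat.mod_eq_of_lt hn]
  have := u.val_lt
  split_ifs with h
  · exact Nat.mod_eq_of_lt h
  · rw [Nat.mod_eq_sub_mod (by omega)]
    exact Nat.mod_eq_of_lt (by omega)

theorem crd_eq (k q c m : ℕ) (hc : c < k) (h : m = q * k + c) : m / k = q ∧ m % k = c := by
  subst h
  constructor
  · rw [Nat.mul_comm, Nat.mul_add_div (by omega), Nat.div_eq_of_lt hc, add_zero]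
  · rw [Nat.mul_comm, Nat.mul_add_mod, Nat.mod_eq_of_lt hc]

theorem crd_of (n k q c : ℕ) (u : ZMod n) (hc : c < k) (h : u.val = q * k + c) :
    crd n k u = ((q : ℤ), (c : ℤ)) := by
  obtain ⟨e1, e2⟩ := crd_eq k q c _ hc h
  unfold crd
  rw [e1, e2]

theorem crd_spec (n k a r : ℕ) (hn : n = a * k + r) (hr : r < k) (h0 : 0 < r) (u : ZMod n) :
    ∃ q c : ℕ, u.val = q * k + c ∧ c < k ∧ q ≤ a ∧ (q = a → c < r) ∧
      crd n k u = ((q : ℤ), (c : ℤ)) := by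
  haveI : NeZero n := ⟨by omega⟩
  have hu := u.val_lt
  have hd : u.val = u.val / k * k + u.val % k := by
    rw [Nat.mul_comm]; exact (Nat.div_add_mod _ _).symm
  have hc : u.val % k < k := Nat.mod_lt _ (by omega)
  refine ⟨u.val / k, u.val % k, hd, hc, ?_, ?_, rfl⟩
  · by_contra hq
    have : (a + 1) * k ≤ u.val / k * k := Nat.mul_le_mul_right _ (by omega)
    rw [Nat.add_mul] at this
    omega
  · intro hq
    rw [hq] at hd
    omega

theorem edge_h (n k a r : ℕ) (hp : Par a k r) (hn : n = a * k + r) (u : ZMod n) :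
    OI a k r (hcol a k r (crd n k u).1 (crd n k u).2) (crd n k u).1 (crd n k u).2
      (crd n k (u+1)).1 (crd n k (u+1)).2 := by
  have hp' := hp
  obtain ⟨h3, h4, h5, h6⟩ := hp'
  have hn1 : 1 < n := by
    have : 0 ≤ a * k := Nat.zero_le _
    omega
  obtain ⟨q, c, hv, hc, hq, hqc, e⟩ := crd_spec n k a r hn (by omega) (by omega) u
  haveI : NeZero n := ⟨by omega⟩
  have hu := u.val_lt
  have hs := val_succ n hn1 u
  by_cases hl : u.val + 1 = n
  · rw [if_pos hl] at hs
    rw [crd_of n k 0 0 (u+1) (by omega) (by omega)]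
    have : q = a ∧ c = r - 1 := by
      have h1 := crd_eq k q c u.val hc hv
      have h2 := crd_eq k a (r-1) u.val (by omega) (by omega)
      omega
    rw [e, this.1, this.2]
    have hr1 : ((r - 1 : ℕ) : ℤ) = (r : ℤ) - 1 := by omega
    simp only [hr1, Nat.cast_zero]
    exact final a k r hp
  rw [if_neg hl] at hs
  by_cases hk : c = k - 1
  · rw [crd_of n k (q+1) 0 (u+1) (by omega) (by rw [hs, hv, Nat.add_mul]; omega), e]
    have hk1 : ((c : ℕ) : ℤ) = (k : ℤ) - 1 := by omega
    simp only [hk1, Nat.cast_zero, Nat.cast_add, Nat.cast_one]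
    exact helix a k r q hp (by omega) (by omega)
  · rw [crd_of n k q (c+1) (u+1) (by omega) (by omega), e]
    simp only [Nat.cast_add, Nat.cast_one]
    rcases Nat.eq_zero_or_pos q with h0 | h0
    · subst h0
      exact hor0 a k r c hp (by omega) (by omega)
    · refine hor1 a k r q c hp (by omega) (by omega) (by omega) (by omega) ?_
      intro h
      have hqa : q = a := by omega
      subst hqa
      have := hqc rfl
      omega

theorem edge_v (n k a r : ℕ) (hp : Par a k r) (hn : n = a * k + r) (u : ZMod n) :
    OI a k r (vcol a k r (crd n k u).1 (crd n k u).2) (crd n k u).1 (crd n k u).2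
      (crd n k (u+k)).1 (crd n k (u+k)).2 := by
  have hp' := hp
  obtain ⟨h3, h4, h5, h6⟩ := hp'
  have hak : 2 * k ≤ a * k := Nat.mul_le_mul_right _ (by omega)
  have hn1 : k < n := by omega
  obtain ⟨q, c, hv, hc, hq, hqc, e⟩ := crd_spec n k a r hn (by omega) (by omega) u
  haveI : NeZero n := ⟨by omega⟩
  have hu := u.val_lt
  have hs := val_addk n k hn1 u
  have hq1 : (q + 1) * k = q * k + k := by rw [Nat.add_mul, Nat.one_mul]
  by_cases hqa : q = a
  · subst hqa
    have hcr := hqc rfl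
    rw [if_neg (by omega)] at hs
    rw [crd_of n k 0 (c+k-r) (u+k) (by omega) (by omega), e]
    have h1 : ((c + k - r : ℕ) : ℤ) = (c : ℤ) + k - r := by omega
    simp only [h1, Nat.cast_zero]
    exact wrap2 q k r c hp (by omega) (by omega)
  by_cases hqb : q = a - 1 ∧ r ≤ c
  · have ha : q + 1 = a := by omega
    rw [ha] at hq1
    rw [if_neg (by omega)] at hs
    rw [crd_of n k 0 (c-r) (u+k) (by omega) (by omega), e]
    have h1 : ((c - r : ℕ) : ℤ) = (c : ℤ) - r := by omega
    have h2 : (q : ℤ) = (a : ℤ) - 1 := by omega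
    simp only [h1, h2, Nat.cast_zero]
    exact wrap1 a k r c hp (by omega) (by omega)
  have hlt : u.val + k < n := by
    by_cases hqb' : q = a - 1
    · have ha : q + 1 = a := by omega
      rw [ha] at hq1
      omega
    · have : (q + 2) * k ≤ a * k := Nat.mul_le_mul_right _ (by omega)
      have h2 : (q + 2) * k = q * k + 2 * k := by rw [Nat.add_mul]
      omega
  rw [if_pos hlt] at hs
  rw [crd_of n k (q+1) c (u+k) hc (by omega), e]
  simp only [Nat.cast_add, Nat.cast_one]
  rcases Nat.eq_zero_or_pos q with h0 | h0
  · subst h0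
    exact vert0 a k r c hp (by omega) (by omega)
  · exact vert1 a k r q c hp (by omega) (by omega) (by omega) (by omega) (by omega)

theorem has5 (n k a r : ℕ) (hp : Par a k r) (hn : n = a * k + r) (hodd : Odd n) :
    HasMBE (circ n k) 5 := by
  have hp' := hp
  obtain ⟨h3, h4, h5, h6⟩ := hp'
  have hak : 2 * k ≤ a * k := Nat.mul_le_mul_right _ (by omega)
  haveI : NeZero n := ⟨by omega⟩
  have n2 : ∀ u : ZMod n, u ≠ u + 1 + 1 := by
    intro u h
    have h' : ((2 : ℕ) : ZMod n) = 0 := by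
      push_cast
      linear_combination -h
    rw [ZMod.natCast_eq_zero_iff] at h'
    have := Nat.le_of_dvd (by omega) h'
    omega
  have n2k : ∀ u : ZMod n, u ≠ u + k + k := by
    intro u h
    have h' : ((2 * k : ℕ) : ZMod n) = 0 := by
      push_cast
      linear_combination -h
    rw [ZMod.natCast_eq_zero_iff] at h'
    have := Nat.le_of_dvd (by omega) h'
    omega
  have hinj : Function.Injective (fun v : ZMod n => fkey k r (crd n k v)) := by
    intro u v h
    obtain ⟨q, c, hv, hc, hq, hqc, e⟩ := crd_spec n k a r hn (by omega) (by omega) u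
    obtain ⟨q', c', hv', hc', hq', hqc', e'⟩ := crd_spec n k a r hn (by omega) (by omega) v
    have hh := fkey_inj a k r hp _ _ (by rw [e]; simp only; omega) (by rw [e']; simp only; omega) h
    rw [e, e', Prod.mk.injEq] at hh
    obtain ⟨g1, g2⟩ := hh
    have g1' : q = q' := by omega
    have g2' : c = c' := by omega
    apply ZMod.val_injective n
    rw [hv, hv', g1', g2']
  let hc : ZMod n → Fin 5 := fun u => hcol a k r (crd n k u).1 (crd n k u).2
  let vc : ZMod n → Fin 5 := fun u => vcol a k r (crd n k u).1 (crd n k u).2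
  refine mbe_of (circ n k) a k r hp (crd n k) hinj
    (fun u v => if v = u + 1 then hc u else if u = v + 1 then hc v else
      if v = u + k then vc u else vc v) ?_ ?_
  · intro u v h
    rw [circ_adj] at h
    obtain ⟨hne, h⟩ := h
    by_cases i1 : v = u + 1
    · have i2 : ¬ u = v + 1 := by rw [i1]; exact n2 u
      simp only [if_pos i1, if_neg i2]
    by_cases i2 : u = v + 1
    · simp only [if_neg i1, if_pos i2]
    by_cases i3 : v = u + k
    · have i4 : ¬ u = v + k := by rw [i3]; exact n2k u
      simp only [if_neg i1, if_neg i2, if_pos i3, if_neg i4]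
    · have i4 : u = v + k := by tauto
      simp only [if_neg i1, if_neg i2, if_neg i3, if_pos i4]
  · intro u v h
    rw [circ_adj] at h
    obtain ⟨hne, h⟩ := h
    split_ifs with i1 i2 i3
    · rw [i1]; exact edge_h n k a r hp hn u
    · rw [i2]; exact OI_symm (edge_h n k a r hp hn v)
    · rw [i3]; exact edge_v n k a r hp hn u
    · have i4 : u = v + k := by tauto
      rw [i4]; exact OI_symm (edge_v n k a r hp hn v)

theorem nat_ne_zero (n j : ℕ) (h0 : 0 < j) (h1 : j < n) : ((j : ℕ) : ZMod n) ≠ 0 := by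
  intro h
  rw [ZMod.natCast_eq_zero_iff] at h
  have := Nat.le_of_dvd h0 h
  omega

theorem nbr_ncard (n k : ℕ) (hk : 2 ≤ k) (hn : 2 * k < n) (v : ZMod n) :
    ((circ n k).neighborSet v).ncard = 4 := by
  have h1 := nat_ne_zero n 1 (by omega) (by omega)
  have h2 := nat_ne_zero n 2 (by omega) (by omega)
  have h3 := nat_ne_zero n k (by omega) (by omega)
  have h4 := nat_ne_zero n (2 * k) (by omega) (by omega)
  have h5 := nat_ne_zero n (k - 1) (by omega) (by omega)
  have h6 := nat_ne_zero n (k + 1) (by omega) (by omega)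
  rw [Nat.cast_sub (by omega)] at h5
  push_cast at h1 h2 h3 h4 h5 h6
  have e : (circ n k).neighborSet v =
      (({v + 1, v - 1, v + k, v - k} : Finset (ZMod n)) : Set (ZMod n)) := by
    ext w
    rw [SimpleGraph.mem_neighborSet, circ_adj]
    simp only [Finset.coe_insert, Finset.coe_singleton, Set.mem_insert_iff,
      Set.mem_singleton_iff, eq_sub_iff_add_eq]
    constructor
    · rintro ⟨-, h | h | h | h⟩
      · exact Or.inl h
      · exact Or.inr (Or.inl h.symm)
      · exact Or.inr (Or.inr (Or.inl h))
      · exact Or.inr (Or.inr (Or.inr h.symm))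
    · rintro (h | h | h | h)
      · refine ⟨fun e => h1 ?_, Or.inl h⟩
        linear_combination -h - e
      · refine ⟨fun e => h1 ?_, Or.inr (Or.inl h.symm)⟩
        linear_combination h + e
      · refine ⟨fun e => h3 ?_, Or.inr (Or.inr (Or.inl h))⟩
        linear_combination -h - e
      · refine ⟨fun e => h3 ?_, Or.inr (Or.inr (Or.inr h.symm))⟩
        linear_combination h + e
  rw [e, Set.ncard_coe_finset]
  rw [Finset.card_insert_of_notMem, Finset.card_insert_of_notMem, Finset.card_insert_of_notMem,
    Finset.card_singleton]
  · simp only [Finset.mem_singleton]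
    intro h
    exact h4 (by linear_combination h)
  · simp only [Finset.mem_insert, Finset.mem_singleton, not_or]
    exact ⟨fun h => h6 (by linear_combination -h), fun h => h5 (by linear_combination h)⟩
  · simp only [Finset.mem_insert, Finset.mem_singleton, not_or]
    exact ⟨fun h => h2 (by linear_combination h), fun h => h5 (by linear_combination -h),
      fun h => h6 (by linear_combination h)⟩

theorem maxDeg_eq (n k : ℕ) (hk : 2 ≤ k) (hn : 2 * k < n) : maxDeg (circ n k) = 4 := by
  unfold maxDeg
  have : (fun v => ((circ n k).neighborSet v).ncard) = fun _ => 4 := by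
    funext v
    exact nbr_ncard n k hk hn v
  rw [this, Set.range_const, csSup_singleton]

theorem lower (n k : ℕ) (hk : 2 ≤ k) (hn : 2 * k < n) (hodd : Odd n) (m : ℕ)
    (h : HasMBE (circ n k) m) : 5 ≤ m := by
  obtain ⟨σ, col, hs, hc, -⟩ := h
  haveI : NeZero n := ⟨by omega⟩
  have inj : ∀ v, Set.InjOn (col v) ((circ n k).neighborSet v) := by
    intro v x hx y hy hxy
    by_contra hne
    exact hc v x y hx hy hne hxy
  have him : ∀ v, (col v '' ((circ n k).neighborSet v)).ncard = 4 := by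
    intro v
    rw [Set.ncard_image_of_injOn (inj v), nbr_ncard n k hk hn v]
  have h4 : 4 ≤ m := by
    have h1 := Set.ncard_le_ncard (Set.subset_univ (col 0 '' ((circ n k).neighborSet 0)))
      Set.finite_univ
    rw [him, Set.ncard_univ, Nat.card_fin] at h1
    exact h1
  by_contra h5
  have hm : m = 4 := by omega
  subst hm
  have sur : ∀ v, ∃ w, (circ n k).Adj v w ∧ col v w = 0 := by
    intro v
    have : col v '' ((circ n k).neighborSet v) = Set.univ := by
      apply Set.eq_of_subset_of_ncard_le (Set.subset_univ _) _ Set.finite_univ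
      rw [him, Set.ncard_univ, Nat.card_fin]
    have h0 : (0 : Fin 4) ∈ col v '' ((circ n k).neighborSet v) := by
      rw [this]; exact Set.mem_univ _
    obtain ⟨w, hw, e⟩ := h0
    exact ⟨w, hw, e⟩
  choose f hf hf0 using sur
  have hff : ∀ v, f (f v) = v := by
    intro v
    apply inj (f v) (hf (f v)) (hf v).symm
    rw [hf0, ← hs v (f v) (hf v), hf0]
  have hsum : ∑ _v : ZMod n, (1 : ZMod 2) = 0 := by
    apply Finset.sum_involution (fun v _ => f v)
    · intro v _; decide
    · intro v _ _; exact (hf v).ne'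
    · intro v _; exact Finset.mem_univ _
    · intro v _; exact hff v
  rw [Finset.sum_const, Finset.card_univ, ZMod.card, nsmul_eq_mul, mul_one,
    ZMod.natCast_eq_zero_iff] at hsum
  obtain ⟨j, hj⟩ := hodd
  omega

/-- `n` odd, `gcd(n,k) = 1`, `n = a·k + r` with `2 ≤ r ≤ k - 2`; with `t`
defined from the remainder algorithm, if `t` is even and `t ≥ 2` then
`mbt(C(n,k)) = Δ(C(n,k)) + 1 = 5`. -/
theorem stmt18 (n k a r : ℕ) (hodd : Odd n) (hk : 4 ≤ k) (hk' : k ≤ n / 2)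
    (hgcd : Nat.gcd n k = 1) (hn : n = a * k + r) (hr : 2 ≤ r) (hr' : r ≤ k - 2)
    (m : ℕ) (hm : (euclidSeq k r (m + 1)).2 = 0)
    (hmmin : ∀ m' < m, (euclidSeq k r (m' + 1)).2 ≠ 0)
    (t : ℕ)
    (ht1 : ∀ s : ℕ, 0 < s → s < m → 3 ≤ (euclidSeq k r s).1 → (euclidSeq k r s).2 = 1 →
      (∀ s' : ℕ, 0 < s' → s' < s →
        ¬(3 ≤ (euclidSeq k r s').1 ∧ (euclidSeq k r s').2 = 1)) →
      t = (euclidSeq k r s).1 + 1)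
    (ht2 : (¬ ∃ s : ℕ, 0 < s ∧ s < m ∧ 3 ≤ (euclidSeq k r s).1 ∧ (euclidSeq k r s).2 = 1) →
      t = (euclidSeq k r m).1)
    (hteven : Even t) (ht2' : 2 ≤ t) :
    mbt (circ n k) = maxDeg (circ n k) + 1 ∧ maxDeg (circ n k) + 1 = 5 := by
  have ha : 2 ≤ a := by
    by_contra hlt
    have h1 : a * k ≤ 1 * k := Nat.mul_le_mul_right _ (by omega)
    omega
  have hn2 : 2 * k < n := by
    rcases eq_or_lt_of_le (show 2 * k ≤ n by omega) with h | h
    · obtain ⟨j, hj⟩ := hodd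
      omega
    · exact h
  have hpar : n % 2 = 1 := Nat.odd_iff.1 hodd
  have hmod : n % 2 = ((a % 2) * (k % 2) + r % 2) % 2 := by
    rw [hn, Nat.add_mod, Nat.mul_mod]
    generalize a % 2 * (k % 2) = x
    omega
  have hp : Par (a : ℤ) (k : ℤ) (r : ℤ) := by
    refine ⟨by omega, by omega, by omega, ?_⟩
    have e1 := Nat.mod_two_eq_zero_or_one a
    have e2 := Nat.mod_two_eq_zero_or_one k
    have e3 := Nat.mod_two_eq_zero_or_one r
    rcases e1 with e1 | e1 <;> rcases e2 with e2 | e2 <;> rcases e3 with e3 | e3 <;>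
      rw [e1, e2, e3] at hmod <;> omega
  have hd := maxDeg_eq n k (by omega) hn2
  have h5 := has5 n k a r hp hn hodd
  have hm5 : mbt (circ n k) = 5 := by
    unfold mbt
    apply le_antisymm
    · exact Nat.sInf_le h5
    · exact le_csInf ⟨5, h5⟩ (fun m hm => lower n k (by omega) hn2 hodd m hm)
  rw [hd, hm5]
  exact ⟨rfl, rfl⟩
end
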